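/- arXiv:2412.02123 — 2 statements merged into one kernel-verified Lean document; each statement's English description precedes it below -/
import Mathlib

section
/- Let K = K(n,Λ) be a generalized Sierpiński carpet satisfying the strong separation condition. Let θ ∈ ℝ, let R_θ denote the counterclockwise rotation of ℝ² about the origin by angle θ, and let f(x) = λ R_θ x + a with λ > 0 and a ∈ ℝ². If f is oblique (equivalently, sin θ ≠ 0 and cos θ ≠ 0) and f(K) ⊆ K, then |tan θ| = 1. -/
open scoped BigOperators

/-- The Bedford–McMullen carpet `K(n,m,Λ)`: the set of points
`(Σ_k i_k n^{-k}, Σ_k j_k m^{-k})` with `(i_k, j_k) ∈ Λ` for all `k ≥ 1`. -/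
def BMCarpet (n m : ℕ) (Λ : Finset (ℕ × ℕ)) : Set (ℝ × ℝ) :=
  { p | ∃ d : ℕ → ℕ × ℕ, (∀ k, d k ∈ Λ) ∧
      p.1 = ∑' k : ℕ, ((d k).1 : ℝ) / (n : ℝ) ^ (k + 1) ∧
      p.2 = ∑' k : ℕ, ((d k).2 : ℝ) / (m : ℝ) ^ (k + 1) }

/-- `f` is a similitude of the Euclidean plane with ratio `l`. -/
def IsSimilitude (f : ℝ × ℝ → ℝ × ℝ) (l : ℝ) : Prop :=
  ∀ x y : ℝ × ℝ,
    Real.sqrt (((f x).1 - (f y).1) ^ 2 + ((f x).2 - (f y).2) ^ 2)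
      = l * Real.sqrt ((x.1 - y.1) ^ 2 + (x.2 - y.2) ^ 2)

/-- `f` is oblique: both coordinates of `f (1,0) - f (0,0)` are nonzero. -/
def Oblique (f : ℝ × ℝ → ℝ × ℝ) : Prop :=
  (f (1, 0)).1 - (f (0, 0)).1 ≠ 0 ∧ (f (1, 0)).2 - (f (0, 0)).2 ≠ 0

/-- `K` is contained in some affine line of the plane. -/
def OnALine (K : Set (ℝ × ℝ)) : Prop :=
  ∃ a b c : ℝ, (a ≠ 0 ∨ b ≠ 0) ∧ ∀ p ∈ K, a * p.1 + b * p.2 = c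

/-- The map `φ_{i,j}(x,y) = ((x+i)/n, (y+j)/n)` of the generalized Sierpiński carpet IFS. -/
noncomputable def sierpMap (n : ℕ) (ij : ℕ × ℕ) (p : ℝ × ℝ) : ℝ × ℝ :=
  ((p.1 + ij.1) / n, (p.2 + ij.2) / n)

/-- The strong separation condition for the generalized Sierpiński carpet. -/
def StrongSep (n : ℕ) (Λ : Finset (ℕ × ℕ)) : Prop :=
  ∀ a ∈ Λ, ∀ b ∈ Λ, a ≠ b →
    Disjoint (sierpMap n a '' BMCarpet n n Λ) (sierpMap n b '' BMCarpet n n Λ)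

namespace DigitExpansion

open Set Filter Topology

variable {D : Type*}

/-- The point of the plane with digit sequence `x` in base `n`, where the digit `d` stands for
the complex number `e d`. -/
noncomputable def point (e : D → ℂ) (n : ℕ) (x : ℕ → D) : ℂ :=
  ∑' k, e (x k) / (n : ℂ) ^ (k + 1)

/-- The sequence `x` with its first `m` terms removed. -/
def shift (m : ℕ) (x : ℕ → D) : ℕ → D := fun k => x (k + m)

/-- The sequence that starts with the first `m` terms of `x` and continues with `y`. -/
def splice (m : ℕ) (x y : ℕ → D) : ℕ → D := fun k => if k < m then x k else y (k - m)

lemma shift_splice (m : ℕ) (x y : ℕ → D) : shift m (splice m x y) = y := by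
  funext k; simp [shift, splice]

lemma splice_eqOn (m : ℕ) (x y : ℕ → D) : EqOn (splice m x y) x (Iio m) := by
  intro k hk; simp only [mem_Iio] at hk; simp [splice, hk]

lemma splice_shift_of_eqOn {m : ℕ} {x y : ℕ → D} (h : EqOn x y (Iio m)) :
    splice m x (shift m y) = y := by
  funext k
  by_cases hk : k < m
  · simpa [splice, hk] using h hk
  · simp [splice, shift, hk, Nat.sub_add_cancel (not_lt.1 hk)]

lemma eqOn_add {m l : ℕ} {x y : ℕ → D} (h : EqOn x y (Iio m))
    (h' : EqOn (shift m x) (shift m y) (Iio l)) : EqOn x y (Iio (m + l)) := by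
  intro k hk
  simp only [mem_Iio] at hk
  by_cases hkm : k < m
  · exact h hkm
  · have := h' (show k - m ∈ Iio l by simp only [mem_Iio]; omega)
    simpa [shift, Nat.sub_add_cancel (not_lt.1 hkm)] using this

lemma eqOn_of_le {m l : ℕ} {x y : ℕ → D} (hml : m ≤ l) (h : EqOn x y (Iio l)) :
    EqOn x y (Iio m) := h.mono (Iio_subset_Iio hml)

lemma ne_of_not_eqOn {m : ℕ} {x y : ℕ → D} (h : ¬ EqOn x y (Iio m)) :
    ∃ k < m, EqOn x y (Iio k) ∧ x k ≠ y k := by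
  classical
  have hex : ∃ k, k < m ∧ x k ≠ y k := by
    by_contra! hcon
    exact h fun k hk => hcon k hk
  refine ⟨Nat.find hex, (Nat.find_spec hex).1, fun k hk => ?_, (Nat.find_spec hex).2⟩
  by_contra hne
  exact Nat.find_min hex hk ⟨(mem_Iio.1 hk).trans (Nat.find_spec hex).1, hne⟩

variable (e : D → ℂ) {n : ℕ}

lemma norm_digit_div_le {B : ℝ} (hB : ∀ d, ‖e d‖ ≤ B) (hn : 2 ≤ n) (d : D) (k : ℕ) :
    ‖e d / (n : ℂ) ^ (k + 1)‖ ≤ B * (1 / 2) ^ (k + 1) := by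
  have h2 : (2 : ℝ) ≤ n := by exact_mod_cast hn
  have hB0 : 0 ≤ B := (norm_nonneg _).trans (hB d)
  rw [norm_div, norm_pow, Complex.norm_natCast, div_eq_mul_inv, one_div, inv_pow]
  gcongr
  exact hB d

lemma summable_geometric_bound (B : ℝ) : Summable fun k : ℕ => B * (1 / 2 : ℝ) ^ (k + 1) :=
  ((summable_nat_add_iff 1).2 summable_geometric_two).mul_left B

section Finite

variable [Finite D]

lemma exists_digit_bound : ∃ B : ℝ, ∀ d, ‖e d‖ ≤ B := by
  obtain ⟨B, hB⟩ := (Set.finite_range fun d => ‖e d‖).bddAbove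
  exact ⟨B, fun d => hB ⟨d, rfl⟩⟩

lemma summable_point (hn : 2 ≤ n) (x : ℕ → D) :
    Summable fun k => e (x k) / (n : ℂ) ^ (k + 1) := by
  obtain ⟨B, hB⟩ := exists_digit_bound e
  exact Summable.of_norm_bounded (summable_geometric_bound B)
    fun k => norm_digit_div_le e hB hn (x k) k

lemma exists_point_bound (hn : 2 ≤ n) :
    ∃ C : ℝ, 0 < C ∧ ∀ x y, ‖point e n x - point e n y‖ ≤ C := by
  obtain ⟨B, hB⟩ := exists_digit_bound e
  have key : ∀ x, ‖point e n x‖ ≤ ∑' k : ℕ, B * (1 / 2 : ℝ) ^ (k + 1) := fun x =>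
    tsum_of_norm_bounded (summable_geometric_bound B).hasSum
      fun k => norm_digit_div_le e hB hn (x k) k
  refine ⟨2 * |∑' k : ℕ, B * (1 / 2 : ℝ) ^ (k + 1)| + 1, by positivity, fun x y => ?_⟩
  have := norm_sub_le (point e n x) (point e n y)
  linarith [key x, key y, le_abs_self (∑' k : ℕ, B * (1 / 2 : ℝ) ^ (k + 1))]

lemma continuous_point [TopologicalSpace D] [DiscreteTopology D] (hn : 2 ≤ n) :
    Continuous (point e n) := by
  obtain ⟨B, hB⟩ := exists_digit_bound e
  exact continuous_tsum
    (fun k => (continuous_of_discreteTopology.comp (continuous_apply k)).div_const _)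
    (summable_geometric_bound B) fun k x => norm_digit_div_le e hB hn (x k) k

lemma point_eq_div (hn : 2 ≤ n) (x : ℕ → D) :
    point e n x = (e (x 0) + point e n (shift 1 x)) / n := by
  have hn0 : (n : ℂ) ≠ 0 := by exact_mod_cast (by omega : n ≠ 0)
  rw [point, (summable_point e hn x).tsum_eq_zero_add, add_div, point, ← tsum_div_const]
  simp only [zero_add, pow_one, shift]
  congr 1
  refine tsum_congr fun k => ?_
  rw [pow_succ (n : ℂ) (k + 1), div_div]

lemma point_sub_of_eqOn (hn : 2 ≤ n) {m : ℕ} {x y : ℕ → D} (h : EqOn x y (Iio m)) :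
    point e n x - point e n y =
      (point e n (shift m x) - point e n (shift m y)) / (n : ℂ) ^ m := by
  have hn0 : (n : ℂ) ≠ 0 := by exact_mod_cast (by omega : n ≠ 0)
  induction m with
  | zero => simp only [pow_zero, div_one]; rfl
  | succ m ih =>
    rw [ih (eqOn_of_le m.le_succ h), point_eq_div e hn (shift m x),
      point_eq_div e hn (shift m y)]
    have h0 : shift m x 0 = shift m y 0 := by simpa [shift] using h (show m ∈ Iio (m + 1) by simp)
    have hs : ∀ z : ℕ → D, shift 1 (shift m z) = shift (m + 1) z := fun z => by
      funext k; simp [shift, add_assoc, add_comm m 1]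
    rw [h0, hs, hs, pow_succ]
    field_simp
    ring

lemma point_splice_sub (hn : 2 ≤ n) (m : ℕ) (x y z : ℕ → D) (h : EqOn z x (Iio m)) :
    point e n (splice m x y) - point e n z =
      (point e n y - point e n (shift m z)) / (n : ℂ) ^ m := by
  rw [point_sub_of_eqOn e hn ((splice_eqOn m x y).trans h.symm), shift_splice]

lemma norm_point_sub_le (hn : 2 ≤ n) {C : ℝ} (hC : ∀ x y, ‖point e n x - point e n y‖ ≤ C)
    {m : ℕ} {x y : ℕ → D} (h : EqOn x y (Iio m)) :
    ‖point e n x - point e n y‖ ≤ C / (n : ℝ) ^ m := by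
  rw [point_sub_of_eqOn e hn h, norm_div, norm_pow, Complex.norm_natCast]
  gcongr
  exact hC _ _

lemma exists_separation (hn : 2 ≤ n) (hinj : Function.Injective (point e n)) :
    ∃ δ : ℝ, 0 < δ ∧ ∀ x y, x 0 ≠ y 0 → δ ≤ ‖point e n x - point e n y‖ := by
  let _ : TopologicalSpace D := ⊥
  have _ : DiscreteTopology D := ⟨rfl⟩
  have hcont := continuous_point e hn
  set S : Set ((ℕ → D) × (ℕ → D)) := {p | p.1 0 ≠ p.2 0} with hS
  have hclosed : IsClosed S := by
    have : Continuous fun p : (ℕ → D) × (ℕ → D) => (p.1 0, p.2 0) := by fun_prop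
    exact (isClosed_discrete {q : D × D | q.1 ≠ q.2}).preimage this
  rcases S.eq_empty_or_nonempty with hem | hne
  · refine ⟨1, one_pos, fun x y hxy => ?_⟩
    have : (x, y) ∈ S := hxy
    simp [hem] at this
  · obtain ⟨p, hp, hmin⟩ := hclosed.isCompact.exists_isMinOn hne
      (f := fun p => ‖point e n p.1 - point e n p.2‖) (by fun_prop)
    refine ⟨_, norm_pos_iff.2 (sub_ne_zero.2 fun h => hp (congrFun (hinj h) 0)),
      fun x y hxy => ?_⟩
    exact hmin (show (x, y) ∈ S from hxy)

lemma eqOn_of_norm_lt (hn : 2 ≤ n) {δ : ℝ} (hδ0 : 0 < δ)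
    (hδ : ∀ x y : ℕ → D, x 0 ≠ y 0 → δ ≤ ‖point e n x - point e n y‖)
    {m : ℕ} {x y : ℕ → D} (h : ‖point e n x - point e n y‖ < δ / (n : ℝ) ^ m) :
    EqOn x y (Iio m) := by
  by_contra hcon
  obtain ⟨k, hkm, heq, hne⟩ := ne_of_not_eqOn hcon
  have h1 : (1 : ℝ) ≤ n := by exact_mod_cast (by omega : 1 ≤ n)
  rw [point_sub_of_eqOn e hn heq, norm_div, norm_pow, Complex.norm_natCast] at h
  have h2 : δ ≤ ‖point e n (shift k x) - point e n (shift k y)‖ :=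
    hδ _ _ (by simpa [shift] using hne)
  have h3 : δ / (n : ℝ) ^ m ≤ δ / (n : ℝ) ^ k := by gcongr
  have h4 : δ / (n : ℝ) ^ k ≤ ‖point e n (shift k x) - point e n (shift k y)‖ / (n : ℝ) ^ k := by
    gcongr
  linarith

lemma exists_pow_div_lt (hn : 2 ≤ n) (C : ℝ) {δ : ℝ} (hδ : 0 < δ) :
    ∃ c : ℕ, C / (n : ℝ) ^ c < δ := by
  have h1 : (1 : ℝ) < n := by exact_mod_cast (by omega : 1 < n)
  obtain ⟨c, hc⟩ := pow_unbounded_of_one_lt (C / δ) h1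
  refine ⟨c, ?_⟩
  rw [div_lt_iff₀ (by positivity)]
  rw [div_lt_iff₀ hδ] at hc
  linarith

/-- A lift `F` to digit sequences of an affine map of the plane distorts the lengths of common
initial words by at most a constant. -/
lemma exists_distortion_const (hn : 2 ≤ n) (hinj : Function.Injective (point e n))
    {w a : ℂ} (hw : w ≠ 0) {F : (ℕ → D) → ℕ → D}
    (hF : ∀ x, point e n (F x) = w * point e n x + a) :
    ∃ c : ℕ, (∀ m x y, EqOn x y (Iio (m + c)) → EqOn (F x) (F y) (Iio m)) ∧
      ∀ m x y, EqOn (F x) (F y) (Iio (m + c)) → EqOn x y (Iio m) := by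
  obtain ⟨C, hC0, hC⟩ := exists_point_bound e hn
  obtain ⟨δ, hδ0, hδ⟩ := exists_separation e hn hinj
  have hn0 : (0 : ℝ) < n := by exact_mod_cast (by omega : 0 < n)
  have hn1 : (1 : ℝ) ≤ n := by exact_mod_cast (by omega : 1 ≤ n)
  have hw0 : 0 < ‖w‖ := norm_pos_iff.2 hw
  have hsub : ∀ x y, ‖point e n (F x) - point e n (F y)‖ =
      ‖w‖ * ‖point e n x - point e n y‖ := fun x y => by
    rw [hF, hF, ← norm_mul]; congr 1; ring
  obtain ⟨c₁, h₁⟩ := exists_pow_div_lt hn (‖w‖ * C) hδ0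
  obtain ⟨c₂, h₂⟩ := exists_pow_div_lt hn (C / ‖w‖) hδ0
  have small : ∀ (B : ℝ) (c m : ℕ), B / (n : ℝ) ^ c < δ →
      B / (n : ℝ) ^ (m + c) < δ / (n : ℝ) ^ m := fun B c m h => by
    rw [add_comm, pow_add, ← div_div]
    gcongr
  refine ⟨max c₁ c₂, fun m x y h => ?_, fun m x y h => ?_⟩
  · refine eqOn_of_norm_lt e hn hδ0 hδ (lt_of_le_of_lt ?_ (small _ _ m h₁))
    rw [hsub, mul_div_assoc]
    gcongr
    exact norm_point_sub_le e hn hC (eqOn_of_le (by gcongr; exact le_max_left _ _) h)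
  · refine eqOn_of_norm_lt e hn hδ0 hδ (lt_of_le_of_lt ?_ (small _ _ m h₂))
    have := norm_point_sub_le e hn hC
      (eqOn_of_le (show m + c₂ ≤ m + max c₁ c₂ by gcongr; exact le_max_right _ _) h)
    rw [hsub] at this
    rw [div_right_comm, le_div_iff₀ hw0]
    linarith

/-- The translation parts of the maps with linear part `A` that send the set of points with a
digit expansion into itself. -/
def translations (n : ℕ) (A : ℂ) : Set ℂ :=
  {b | ∀ x, A * point e n x + b ∈ range (point e n)}

lemma isCompact_range_affine (hn : 2 ≤ n) (A b : ℂ) :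
    IsCompact (range fun x => A * point e n x + b) := by
  let _ : TopologicalSpace D := ⊥
  have _ : DiscreteTopology D := ⟨rfl⟩
  have := continuous_point e hn
  exact isCompact_range (by fun_prop)

lemma isCompact_translations [Nonempty D] (hn : 2 ≤ n) (A : ℂ) :
    IsCompact (translations e n A) := by
  have hK : IsCompact (range (point e n)) := by
    simpa using isCompact_range_affine e hn 1 0
  let x₀ : ℕ → D := fun _ => Classical.arbitrary D
  have hclosed : IsClosed (translations e n A) := by
    have : translations e n A = ⋂ x, (fun b => A * point e n x + b) ⁻¹' range (point e n) := by
      ext b; simp [translations]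
    rw [this]
    exact isClosed_iInter fun x => hK.isClosed.preimage (by fun_prop)
  refine (hK.image (f := fun p => p - A * point e n x₀) (by fun_prop)).of_isClosed_subset hclosed ?_
  intro b hb
  exact ⟨_, hb x₀, by ring⟩

/-- If no image `A K + b ⊆ K` contains a cylinder, then every cylinder of a given level has a
subcylinder of a uniform level that avoids `A K + b`. -/
lemma exists_level_avoiding [Nonempty D] (hn : 2 ≤ n) {A : ℂ}
    (hA : ∀ b ∈ translations e n A, ∀ z j, ∃ y, EqOn y z (Iio j) ∧
      point e n y ∉ range fun x => A * point e n x + b) (j : ℕ) :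
    ∃ q ≥ j, ∀ b ∈ translations e n A, ∀ z, ∃ y, EqOn y z (Iio j) ∧
      ∀ y', EqOn y' y (Iio q) → point e n y' ∉ range fun x => A * point e n x + b := by
  let _ : TopologicalSpace D := ⊥
  have _ : DiscreteTopology D := ⟨rfl⟩
  obtain ⟨C, hC0, hC⟩ := exists_point_bound e hn
  suffices H : ∃ q ≥ j, ∀ p ∈ translations e n A ×ˢ (univ : Set (ℕ → D)),
      ∃ y, EqOn y p.2 (Iio j) ∧
        ∀ y', EqOn y' y (Iio q) → point e n y' ∉ range fun x => A * point e n x + p.1 by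
    obtain ⟨q, hq, h⟩ := H
    exact ⟨q, hq, fun b hb z => h (b, z) ⟨hb, mem_univ _⟩⟩
  refine ((isCompact_translations e hn A).prod isCompact_univ).induction_on
    (p := fun s => ∃ q ≥ j, ∀ p ∈ s, ∃ y, EqOn y p.2 (Iio j) ∧
        ∀ y', EqOn y' y (Iio q) → point e n y' ∉ range fun x => A * point e n x + p.1)
    ⟨j, le_rfl, by simp⟩ ?_ ?_ ?_
  · rintro s t hst ⟨q, hq, h⟩
    exact ⟨q, hq, fun p hp => h p (hst hp)⟩
  · rintro s t ⟨q₁, hq₁, h₁⟩ ⟨q₂, hq₂, h₂⟩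
    refine ⟨max q₁ q₂, hq₁.trans (le_max_left _ _), ?_⟩
    rintro p (hp | hp)
    · obtain ⟨y, hy, h⟩ := h₁ p hp
      exact ⟨y, hy, fun y' hy' => h y' (eqOn_of_le (le_max_left _ _) hy')⟩
    · obtain ⟨y, hy, h⟩ := h₂ p hp
      exact ⟨y, hy, fun y' hy' => h y' (eqOn_of_le (le_max_right _ _) hy')⟩
  · rintro ⟨b, z⟩ ⟨hb, -⟩
    obtain ⟨y, hyz, hy⟩ := hA b hb z j
    obtain ⟨η, hη, hball⟩ := Metric.isOpen_iff.1
      (isCompact_range_affine e hn A b).isClosed.isOpen_compl _ hy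
    obtain ⟨q, hq⟩ := exists_pow_div_lt hn C (half_pos hη)
    refine ⟨{p | dist p.1 b < η / 2 ∧ EqOn p.2 z (Iio j)}, mem_nhdsWithin_of_mem_nhds ?_,
      max q j, le_max_right _ _, ?_⟩
    · have h1 : ∀ᶠ p : ℂ × (ℕ → D) in 𝓝 (b, z), dist p.1 b < η / 2 :=
        (continuous_fst.tendsto (b, z)).eventually (Metric.ball_mem_nhds b (half_pos hη))
      have h2 : ∀ᶠ p : ℂ × (ℕ → D) in 𝓝 (b, z), ∀ k ∈ Iio j, p.2 k = z k := by
        refine (eventually_all_finite (finite_Iio j)).2 fun k _ => ?_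
        have : Continuous fun p : ℂ × (ℕ → D) => p.2 k := by fun_prop
        exact (this.tendsto (b, z)).eventually (mem_nhds_discrete.2 (mem_singleton _))
      exact h1.and h2
    · rintro ⟨b', z'⟩ ⟨hb', hz'⟩
      refine ⟨y, hyz.trans hz'.symm, ?_⟩
      rintro y' hy' ⟨x, hx⟩
      refine hball ?_ ⟨x, rfl⟩
      have h1 : dist b' b < η / 2 := hb'
      have h2 := norm_point_sub_le e hn hC (eqOn_of_le (le_max_left q j) hy')
      rw [dist_comm, dist_eq_norm] at h1
      rw [Metric.mem_ball, dist_eq_norm]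
      have h3 : A * point e n x + b - point e n y =
          (b - b') + (point e n y' - point e n y) := by
        rw [← hx]; ring
      rw [h3]
      linarith [norm_add_le (b - b') (point e n y' - point e n y)]

lemma exists_level_avoiding_finset [Nonempty D] (hn : 2 ≤ n) {A : ℂ}
    (hA : ∀ b ∈ translations e n A, ∀ z j, ∃ y, EqOn y z (Iio j) ∧
      point e n y ∉ range fun x => A * point e n x + b) (M : ℕ) :
    ∃ q, ∀ B : Finset ℂ, B.card ≤ M → (∀ b ∈ B, b ∈ translations e n A) →
      ∃ y, ∀ b ∈ B, ∀ y', EqOn y' y (Iio q) →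
        point e n y' ∉ range fun x => A * point e n x + b := by
  classical
  induction M with
  | zero =>
    refine ⟨0, fun B hB _ => ⟨fun _ => Classical.arbitrary D, ?_⟩⟩
    simp [Finset.card_eq_zero.1 (Nat.le_zero.1 hB)]
  | succ M ih =>
    obtain ⟨q, hq⟩ := ih
    obtain ⟨q', hqq', hq'⟩ := exists_level_avoiding e hn hA q
    refine ⟨q', fun B hB hBt => ?_⟩
    rcases B.eq_empty_or_nonempty with rfl | ⟨b₀, hb₀⟩
    · exact ⟨fun _ => Classical.arbitrary D, by simp⟩
    obtain ⟨z, hz⟩ := hq (B.erase b₀) (by rw [Finset.card_erase_of_mem hb₀]; omega)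
      fun b hb => hBt b (Finset.mem_of_mem_erase hb)
    obtain ⟨y, hyz, hy⟩ := hq' b₀ (hBt b₀ hb₀) z
    refine ⟨y, fun b hb y' hy' => ?_⟩
    by_cases hbb : b = b₀
    · exact hbb ▸ hy y' hy'
    · exact hz b (Finset.mem_erase.2 ⟨hbb, hb⟩) y' ((eqOn_of_le hqq' hy').trans hyz)

/-- The word formed by the first `m` terms of `x`. -/
def pre (m : ℕ) (x : ℕ → D) : Fin m → D := fun i => x i

omit [Finite D] in
lemma pre_eq_pre {m : ℕ} {x y : ℕ → D} : pre m x = pre m y ↔ EqOn x y (Iio m) :=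
  ⟨fun h k hk => congrFun h ⟨k, hk⟩, fun h => funext fun i => h i.2⟩

omit [Finite D] in
lemma exists_pre_eq [Nonempty D] {m : ℕ} (u : Fin m → D) : ∃ x, pre m x = u :=
  ⟨fun k => if h : k < m then u ⟨k, h⟩ else Classical.arbitrary D, by funext i; simp [pre]⟩

lemma ncard_range_pre_add_le {F : (ℕ → D) → ℕ → D} {m q : ℕ}
    (h : ∀ x, ∃ y, ∀ x', EqOn (F x') (F x) (Iio m) → ¬ EqOn (shift m (F x')) y (Iio q)) :
    (range fun x => pre (m + q) (F x)).ncard ≤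
      (Nat.card D ^ q - 1) * (range fun x => pre m (F x)).ncard := by
  classical
  have := Fintype.ofFinite D
  rw [ncard_eq_toFinset_card', ncard_eq_toFinset_card']
  set r : (Fin (m + q) → D) → Fin m → D := fun u i => u (Fin.castAdd q i)
  have himage : (range fun x => pre m (F x)).toFinset =
      (range fun x => pre (m + q) (F x)).toFinset.image r := by
    ext u
    simp only [mem_toFinset, Finset.mem_image, mem_range]
    constructor
    · rintro ⟨x, rfl⟩
      exact ⟨_, ⟨x, rfl⟩, rfl⟩
    · rintro ⟨_, ⟨x, rfl⟩, rfl⟩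
      exact ⟨x, rfl⟩
  rw [himage]
  refine Finset.card_le_mul_card_image _ _ fun u hu => ?_
  rw [← himage, mem_toFinset] at hu
  obtain ⟨x, rfl⟩ := hu
  obtain ⟨y, hy⟩ := h x
  have hcard : (Finset.univ.erase (pre q y)).card = Nat.card D ^ q - 1 := by
    rw [Finset.card_erase_of_mem (Finset.mem_univ _)]
    simp
  rw [← hcard]
  refine Finset.card_le_card_of_injOn (fun u i => u (Fin.natAdd m i)) ?_ ?_
  · intro v hv
    simp only [Finset.coe_filter, mem_toFinset, mem_range, mem_ofPred_eq] at hv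
    obtain ⟨⟨x', rfl⟩, hx'⟩ := hv
    simp only [Finset.coe_erase, Finset.coe_univ, Set.mem_sdiff, mem_univ, true_and,
      mem_singleton_iff]
    intro heq
    refine hy x' (pre_eq_pre.1 hx') (pre_eq_pre.1 (.trans ?_ heq))
    funext i
    simp [pre, shift, add_comm]
  · intro v hv v' hv' hvv'
    simp only [Finset.coe_filter, mem_ofPred_eq] at hv hv'
    funext i
    induction i using Fin.addCases with
    | left i => exact congrFun (hv.2.trans hv'.2.symm) i
    | right i => exact congrFun hvv' i

lemma card_pow_le_ncard_range_pre [Nonempty D] {F : (ℕ → D) → ℕ → D} {c : ℕ}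
    (hF : ∀ m x y, EqOn (F x) (F y) (Iio (m + c)) → EqOn x y (Iio m)) (m : ℕ) :
    Nat.card D ^ m ≤ (range fun x => pre (m + c) (F x)).ncard := by
  choose s hs using fun u : Fin m → D => exists_pre_eq u
  have hinj : Function.Injective fun u => pre (m + c) (F (s u)) := fun u v huv => by
    rw [← hs u, ← hs v]
    exact pre_eq_pre.2 (hF m _ _ (pre_eq_pre.1 huv))
  calc Nat.card D ^ m = (range fun u => pre (m + c) (F (s u))).ncard := by
        rw [← Nat.card_coe_set_eq, Nat.card_range_of_injective hinj, Nat.card_fun, Nat.card_fin]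
    _ ≤ _ := ncard_le_ncard (range_subset_iff.2 fun u => mem_range_self (s u)) (toFinite _)

lemma exists_pow_mul_lt_pow (a b : ℕ) (ha : 0 < a) : ∃ k, (a - 1) ^ k * b < a ^ k := by
  rcases Nat.lt_or_ge 1 a with h1 | h1
  · have hpos : (0 : ℝ) < (a - 1 : ℕ) := by exact_mod_cast (by omega : 0 < a - 1)
    have hlt : (1 : ℝ) < a / (a - 1 : ℕ) := by
      rw [one_lt_div hpos]
      exact_mod_cast (by omega : a - 1 < a)
    obtain ⟨k, hk⟩ := pow_unbounded_of_one_lt (b : ℝ) hlt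
    refine ⟨k, ?_⟩
    rw [div_pow, lt_div_iff₀ (by positivity)] at hk
    rw [mul_comm]
    exact_mod_cast hk
  · obtain rfl : a = 1 := by omega
    exact ⟨1, by simp⟩

/-- A similarity of the plane mapping `K` into itself has a rescaling by a positive real factor
and a translation that still maps `K` into itself and whose image contains a cylinder. -/
lemma exists_lift_covering_cylinder [Nonempty D] (hn : 2 ≤ n)
    (hinj : Function.Injective (point e n)) {w a : ℂ} (hw : w ≠ 0) {F : (ℕ → D) → ℕ → D}
    (hF : ∀ x, point e n (F x) = w * point e n x + a) :
    ∃ (r : ℝ) (b : ℂ) (G : (ℕ → D) → ℕ → D), 0 < r ∧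
      (∀ x, point e n (G x) = r * w * point e n x + b) ∧
      ∃ z m, ∀ y, EqOn y z (Iio m) → y ∈ range G := by
  have hn0 : (n : ℂ) ≠ 0 := by exact_mod_cast (by omega : n ≠ 0)
  obtain ⟨c, hc, hc'⟩ := exists_distortion_const e hn hinj hw hF
  have hr : 0 < ((n : ℝ) ^ c)⁻¹ := by
    have : (0 : ℝ) < n := by exact_mod_cast (by omega : 0 < n)
    positivity
  set A : ℂ := ((((n : ℝ) ^ c)⁻¹ : ℝ) : ℂ) * w with hAdef
  by_contra hcon
  have hA : ∀ b ∈ translations e n A, ∀ z j, ∃ y, EqOn y z (Iio j) ∧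
      point e n y ∉ range fun x => A * point e n x + b := by
    intro b hb z j
    by_contra! hall
    choose G hG using hb
    refine hcon ⟨_, b, G, hr, hG, z, j, fun y hy => ?_⟩
    obtain ⟨x, hx⟩ := hall y hy
    exact ⟨x, hinj ((hG x).trans hx)⟩
  obtain ⟨q, hq⟩ := exists_level_avoiding_finset e hn hA (Nat.card (Fin (2 * c) → D))
  set t : ℕ → (ℕ → D) → ℂ := fun m x =>
    point e n (shift m (F x)) - A * point e n (shift (m + c) x) with ht
  have t_congr : ∀ m x x', EqOn x x' (Iio (m + c)) → t m x = t m x' := by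
    intro m x x' h
    have h1 := point_sub_of_eqOn e hn h
    have h2 := point_sub_of_eqOn e hn (hc m x x' h)
    have h3 : w * (point e n x - point e n x') = point e n (F x) - point e n (F x') := by
      rw [hF, hF]; ring
    rw [h1, h2, pow_add, eq_div_iff (pow_ne_zero m hn0)] at h3
    simp only [ht, hAdef]
    push_cast
    rw [sub_eq_sub_iff_sub_eq_sub, ← h3]
    field_simp
  have t_mem : ∀ m x, t m x ∈ translations e n A := by
    intro m x y
    rw [t_congr m x _ (splice_eqOn (m + c) x y).symm]
    exact ⟨shift m (F (splice (m + c) x y)), by simp [ht, shift_splice]⟩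
  have step : ∀ m, (range fun x => pre (m + q) (F x)).ncard ≤
      (Nat.card D ^ q - 1) * (range fun x => pre m (F x)).ncard := by
    refine fun m => ncard_range_pre_add_le fun x₀ => ?_
    set T : Set ℂ := t m '' {x | EqOn (F x) (F x₀) (Iio m)} with hT
    choose s hs hst using fun b : T => b.2
    have hsinj : Function.Injective fun b : T => pre (2 * c) (shift m (F (s b))) := by
      intro b b' hbb
      have h1 := eqOn_add ((hs b).trans (hs b').symm) (pre_eq_pre.1 hbb)
      rw [two_mul, ← add_assoc] at h1
      exact Subtype.ext ((hst b).symm.trans ((t_congr m _ _ (hc' _ _ _ h1)).trans (hst b')))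
    have hTfin : T.Finite := Finite.of_injective _ hsinj
    obtain ⟨y, hy⟩ := hq hTfin.toFinset
      (by rw [← ncard_eq_toFinset_card T hTfin, ← Nat.card_coe_set_eq]
          exact Nat.card_le_card_of_injective _ hsinj)
      (by
        intro b hb
        obtain ⟨x, -, rfl⟩ := hTfin.mem_toFinset.1 hb
        exact t_mem m x)
    refine ⟨y, fun x hx hxy => ?_⟩
    exact hy (t m x) (hTfin.mem_toFinset.2 ⟨x, hx, rfl⟩) _ hxy
      ⟨shift (m + c) x, by simp [ht]⟩
  have upper : ∀ k, (range fun x => pre (q * k + c) (F x)).ncard ≤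
      (Nat.card D ^ q - 1) ^ k * (range fun x => pre c (F x)).ncard := by
    intro k
    induction k with
    | zero => rw [mul_zero, zero_add, pow_zero, one_mul]
    | succ k ih =>
      rw [show q * (k + 1) + c = q * k + c + q by ring, pow_succ', mul_assoc]
      exact (step _).trans (Nat.mul_le_mul_left _ ih)
  obtain ⟨k, hk⟩ := exists_pow_mul_lt_pow (Nat.card D ^ q)
    (range fun x => pre c (F x)).ncard (pow_pos Nat.card_pos q)
  rw [← pow_mul] at hk
  exact absurd ((card_pow_le_ncard_range_pre hc' (q * k)).trans (upper k)) (not_le.2 hk)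

/-- A similarity of the plane with linear part `w` mapping `K` into itself gives rise to one
with linear part a positive real multiple of `w⁻¹` whose image is relatively open in `K`. -/
lemma exists_open_lift_inv [Nonempty D] (hn : 2 ≤ n) (hinj : Function.Injective (point e n))
    {w a : ℂ} (hw : w ≠ 0) {F : (ℕ → D) → ℕ → D}
    (hF : ∀ x, point e n (F x) = w * point e n x + a) :
    ∃ (s : ℝ) (b : ℂ) (H : (ℕ → D) → ℕ → D), 0 < s ∧
      (∀ x, point e n (H x) = s * w⁻¹ * point e n x + b) ∧
      ∀ x, ∃ m, ∀ y, EqOn y (H x) (Iio m) → y ∈ range H := by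
  obtain ⟨r, b, G, hr, hG, z, m, hz⟩ := exists_lift_covering_cylinder e hn hinj hw hF
  have hn0 : (0 : ℝ) < n := by exact_mod_cast (by omega : 0 < n)
  have hnC : (n : ℂ) ≠ 0 := by exact_mod_cast hn0.ne'
  have hrC : (r : ℂ) ≠ 0 := by exact_mod_cast hr.ne'
  have hA : (r : ℂ) * w ≠ 0 := mul_ne_zero hrC hw
  have hGinj : Function.Injective G := fun x y hxy => hinj <| mul_left_cancel₀ hA <| by
    have h1 := hG x
    rw [hxy, hG y] at h1
    exact (add_right_cancel h1).symm
  obtain ⟨c, hc, -⟩ := exists_distortion_const e hn hinj hA hG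
  choose H hH using fun x => hz (splice m z x) (splice_eqOn m z x)
  refine ⟨(r * (n : ℝ) ^ m)⁻¹,
    (point e n z - point e n (shift m z) / (n : ℂ) ^ m - b) / (r * w), H, by positivity,
    fun x => ?_, fun x => ⟨m + c, fun y hy => ⟨shift m (G y), hGinj ?_⟩⟩⟩
  · have h1 := hG (H x)
    have h2 := point_splice_sub e hn m z x z fun _ _ => rfl
    rw [hH] at h1
    have h3 : r * w * point e n (H x) =
        point e n z + (point e n x - point e n (shift m z)) / (n : ℂ) ^ m - b := by
      linear_combination h2 - h1
    rw [← mul_right_inj' hA, h3]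
    push_cast
    field_simp
    ring
  · rw [hH]
    refine splice_shift_of_eqOn fun k hk => ?_
    rw [hc m _ _ hy hk, hH, splice_eqOn m z x hk]

lemma inner_div_pow (u z : ℂ) (n k : ℕ) :
    inner ℝ u (z / (n : ℂ) ^ k) = inner ℝ u z / (n : ℝ) ^ k := by
  have : z / (n : ℂ) ^ k = ((n : ℝ) ^ k)⁻¹ • z := by
    rw [Complex.real_smul]; push_cast; rw [div_eq_inv_mul]
  rw [this, real_inner_smul_right, div_eq_inv_mul]

lemma inner_mul_mul (β u z : ℂ) :
    inner ℝ (β * u) (β * z) = Complex.normSq β * inner ℝ u z := by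
  simp only [Complex.inner, map_mul, Complex.mul_re, Complex.mul_im, Complex.conj_re,
    Complex.conj_im, Complex.normSq_apply]
  ring

/-- The digit `d` maximizes the linear functional with gradient `u`. -/
def IsMaxDigit (u : ℂ) (d : D) : Prop := ∀ d', inner ℝ u (e d') ≤ inner ℝ u (e d)

lemma inner_point_le (hn : 2 ≤ n) {u : ℂ} {x : ℕ → D} (hx : ∀ k, IsMaxDigit e u (x k))
    (y : ℕ → D) : inner ℝ u (point e n y) ≤ inner ℝ u (point e n x) := by
  have hsum : ∀ z : ℕ → D, HasSum (fun k => inner ℝ u (e (z k)) / (n : ℝ) ^ (k + 1))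
      (inner ℝ u (point e n z)) := fun z => by
    have h := (summable_point e hn z).hasSum.mapL (innerSL ℝ u)
    simp only [innerSL_apply_apply, inner_div_pow] at h
    exact h
  refine hasSum_le (fun k => ?_) (hsum y) (hsum x)
  gcongr
  exact hx k (y k)

lemma isMaxDigit_of_inner_point_le (hn : 2 ≤ n) {u : ℂ} {x : ℕ → D}
    (hx : ∀ y, inner ℝ u (point e n y) ≤ inner ℝ u (point e n x)) (k : ℕ) :
    IsMaxDigit e u (x k) := by
  intro d
  have hn0 : (0 : ℝ) < n := by exact_mod_cast (by omega : 0 < n)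
  have h1 := hx (splice k x (splice 1 (fun _ => d) (shift (k + 1) x)))
  rw [← sub_nonpos, ← inner_sub_right, point_splice_sub e hn k x _ x fun _ _ => rfl,
    point_eq_div e hn (splice 1 _ _), point_eq_div e hn (shift k x), shift_splice,
    inner_div_pow] at h1
  have h2 : shift 1 (shift k x) = shift (k + 1) x := by
    funext l; simp [shift, add_assoc, add_comm k 1]
  have h3 : ∀ z : ℂ, (e (splice 1 (fun _ => d) (shift (k + 1) x) 0) + z) / n -
      (e (shift k x 0) + z) / n = (e d - e (x k)) / (n : ℂ) ^ 1 := fun z => by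
    simp [splice, shift]; ring
  rw [h2, h3, inner_div_pow, inner_sub_right] at h1
  have h4 : ∀ m : ℕ, (0 : ℝ) < (n : ℝ) ^ m := fun m => by positivity
  rw [div_le_iff₀ (h4 _), zero_mul, div_le_iff₀ (h4 _), zero_mul] at h1
  linarith

/-- The nonzero vector `u` is an outer normal of an edge of the convex hull of the digits. -/
def IsEdgeNormal (u : ℂ) : Prop := ∃ d d', d ≠ d' ∧ IsMaxDigit e u d ∧ IsMaxDigit e u d'

lemma exists_isEdgeNormal [Nontrivial D] :
    ∃ u ≠ 0, IsEdgeNormal e u := by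
  obtain ⟨d₀, hd₀⟩ := Finite.exists_max fun d => (e d).re
  by_cases h : ∃ d ≠ d₀, (e d).re = (e d₀).re
  · obtain ⟨d, hd, hre⟩ := h
    exact ⟨1, one_ne_zero, d, d₀, hd, fun d' => by simpa [Complex.inner, hre] using hd₀ d',
      fun d' => by simpa [Complex.inner] using hd₀ d'⟩
  push Not at h
  have hlt : ∀ d ≠ d₀, (e d).re - (e d₀).re < 0 := fun d hd =>
    sub_neg.2 (lt_of_le_of_ne (hd₀ d) (h d hd))
  have : Nonempty {d // d ≠ d₀} := let ⟨d, hd⟩ := exists_ne d₀; ⟨⟨d, hd⟩⟩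
  obtain ⟨⟨d₁, hd₁⟩, hmax⟩ := Finite.exists_max fun d : {d // d ≠ d₀} =>
    ((e d).im - (e d₀).im) / ((e d).re - (e d₀).re)
  set s := ((e d₁).im - (e d₀).im) / ((e d₁).re - (e d₀).re) with hs
  have hd₁s : (e d₁).im - (e d₀).im = s * ((e d₁).re - (e d₀).re) := by
    rw [hs, div_mul_cancel₀ _ (hlt d₁ hd₁).ne]
  have hinner : ∀ z : ℂ, inner ℝ (⟨s, -1⟩ : ℂ) z = s * z.re - z.im := fun z => by
    simp [Complex.inner]
    ring
  have hle : ∀ d, s * (e d).re - (e d).im ≤ s * (e d₀).re - (e d₀).im := fun d => by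
    by_cases hd : d = d₀
    · rw [hd]
    · have := hmax ⟨d, hd⟩
      rw [div_le_iff_of_neg (hlt d hd)] at this
      linarith
  refine ⟨⟨s, -1⟩, fun h0 => by simpa using congrArg Complex.im h0, d₀, d₁, hd₁.symm,
    fun d => ?_, fun d => ?_⟩ <;> rw [hinner, hinner]
  · exact hle d
  · linarith [hle d]

lemma IsEdgeNormal.mul (hn : 2 ≤ n) (hinj : Function.Injective (point e n)) {β b : ℂ}
    (hβ : β ≠ 0) {H : (ℕ → D) → ℕ → D} (hH : ∀ x, point e n (H x) = β * point e n x + b)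
    (hopen : ∀ x, ∃ m, ∀ y, EqOn y (H x) (Iio m) → y ∈ range H) {u : ℂ}
    (hu : IsEdgeNormal e u) : IsEdgeNormal e (β * u) := by
  obtain ⟨d, d', hdd, hd, hd'⟩ := hu
  obtain ⟨c, hc, -⟩ := exists_distortion_const e hn hinj hβ hH
  have hn0 : (0 : ℝ) < n := by exact_mod_cast (by omega : 0 < n)
  set x₀ : ℕ → D := fun _ => d
  obtain ⟨m, hm⟩ := hopen x₀
  set x₁ : ℕ → D := splice (m + c) x₀ fun _ => d' with hx₁
  have hmax : ∀ x, (∀ k, IsMaxDigit e u (x k)) → EqOn (H x) (H x₀) (Iio m) →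
      ∀ k, IsMaxDigit e (β * u) (shift m (H x) k) := by
    intro x hx hxm k
    refine isMaxDigit_of_inner_point_le e hn (fun y => ?_) k
    obtain ⟨x', hx'⟩ := hm _ (splice_eqOn m (H x₀) y)
    have h1 := point_splice_sub e hn m (H x₀) y (H x) hxm
    rw [← hx', hH, hH, add_sub_add_right_eq_sub, ← mul_sub] at h1
    have h2 := congrArg (inner ℝ (β * u)) h1
    rw [inner_mul_mul, inner_div_pow, inner_sub_right, inner_sub_right] at h2
    have h3 := inner_point_le e hn hx x'
    have h4 : (0 : ℝ) < (n : ℝ) ^ m := by positivity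
    have h5 : Complex.normSq β * (inner ℝ u (point e n x') - inner ℝ u (point e n x)) ≤ 0 :=
      mul_nonpos_of_nonneg_of_nonpos (Complex.normSq_nonneg β) (sub_nonpos.2 h3)
    rw [h2, div_le_iff₀ h4, zero_mul] at h5
    linarith
  have hx₁m : EqOn (H x₁) (H x₀) (Iio m) := hc m _ _ (splice_eqOn _ _ _)
  have hne : H x₁ ≠ H x₀ := by
    intro heq
    have h1 := hH x₁
    rw [heq, hH] at h1
    have h2 := congrFun (hinj (mul_left_cancel₀ hβ (add_right_cancel h1))) (m + c)
    exact hdd (by simpa [hx₁, splice, x₀] using h2)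
  obtain ⟨k, hk⟩ := Function.ne_iff.1 hne
  have hmk : m ≤ k := not_lt.1 fun hkm => hk (hx₁m hkm)
  have h0 := hmax x₀ (fun _ => hd) (fun _ _ => rfl) (k - m)
  have h1 := hmax x₁ (fun l => by
    by_cases hl : l < m + c
    · simpa [hx₁, splice, hl, x₀] using hd
    · simpa [hx₁, splice, hl] using hd') hx₁m (k - m)
  simp only [shift, Nat.sub_add_cancel hmk] at h0 h1
  exact ⟨_, _, hk, h1, h0⟩

lemma im_mul_mul_conj_eq_zero {u v v' β : ℂ} (hu : u ≠ 0) (h : inner ℝ u v = 0)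
    (h' : inner ℝ (β * u) v' = 0) : (β * v * (starRingEnd ℂ) v').im = 0 := by
  simp only [Complex.inner, Complex.mul_re, Complex.mul_im, Complex.conj_re, Complex.conj_im]
    at h h' ⊢
  by_cases hx : u.re = 0
  · have hy : u.im ≠ 0 := fun hy => hu (Complex.ext hx hy)
    refine (mul_eq_zero.1 ?_).resolve_left hy
    linear_combination -v.re * h' + (β.im * v'.im + β.re * v'.re) * h
  · refine (mul_eq_zero.1 ?_).resolve_left hx
    linear_combination v.im * h' + (-β.re * v'.im + β.im * v'.re) * h

lemma exists_im_eq_zero [Nontrivial D] (hn : 2 ≤ n) (hinj : Function.Injective (point e n))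
    {w a : ℂ} (hw : w ≠ 0) {F : (ℕ → D) → ℕ → D}
    (hF : ∀ x, point e n (F x) = w * point e n x + a) :
    (∃ m > 0, (w⁻¹ ^ m).im = 0) ∧ ∃ d₀ d₀' d₁ d₁', e d₀ ≠ e d₀' ∧ e d₁ ≠ e d₁' ∧
      (w⁻¹ * (e d₀ - e d₀') * (starRingEnd ℂ) (e d₁ - e d₁')).im = 0 := by
  have he : Function.Injective e := fun d d' h => by
    have : point e n (fun _ => d) = point e n (fun _ => d') := by simp only [point, h]
    exact congrFun (hinj this) 0
  obtain ⟨s, b, H, hs, hH, hopen⟩ := exists_open_lift_inv e hn hinj hw hF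
  have hsC : (s : ℂ) ≠ 0 := by exact_mod_cast hs.ne'
  have hβ : s * w⁻¹ ≠ 0 := mul_ne_zero hsC (inv_ne_zero hw)
  obtain ⟨u, hu, hedge⟩ := exists_isEdgeNormal e
  have hpow : ∀ k, IsEdgeNormal e ((s * w⁻¹) ^ k * u) := fun k => by
    induction k with
    | zero => simpa using hedge
    | succ k ih => rw [pow_succ', mul_assoc]; exact ih.mul e hn hinj hβ hH hopen
  choose p p' hpp hp hp' using hpow
  have hinner : ∀ k, inner ℝ ((s * w⁻¹) ^ k * u) (e (p k) - e (p' k)) = 0 := fun k => by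
    rw [inner_sub_right, sub_eq_zero]
    exact le_antisymm (hp' k _) (hp k _)
  have him : ∀ (m : ℕ) (z : ℂ), ((s * w⁻¹) ^ m * z).im = 0 → (w⁻¹ ^ m * z).im = 0 := by
    intro m z h
    rw [mul_pow, mul_assoc, ← Complex.ofReal_pow, Complex.im_ofReal_mul] at h
    exact (mul_eq_zero.1 h).resolve_left (pow_pos hs m).ne'
  constructor
  · obtain ⟨i, j, hij, heq⟩ := Finite.exists_ne_map_eq_of_infinite fun k => (p k, p' k)
    wlog hlt : i < j generalizing i j
    · exact this j i hij.symm heq.symm (lt_of_le_of_ne (not_lt.1 hlt) hij.symm)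
    refine ⟨j - i, Nat.sub_pos_of_lt hlt, ?_⟩
    simp only [Prod.mk.injEq] at heq
    have hj := hinner j
    rw [← heq.1, ← heq.2, ← Nat.sub_add_cancel hlt.le, pow_add, mul_assoc] at hj
    have h := im_mul_mul_conj_eq_zero (mul_ne_zero (pow_ne_zero i hβ) hu) (hinner i) hj
    rw [mul_assoc, Complex.mul_conj] at h
    have h' := him _ _ h
    rw [Complex.im_mul_ofReal] at h'
    exact (mul_eq_zero.1 h').resolve_right
      (Complex.normSq_eq_zero.not.2 (sub_ne_zero.2 fun h => hpp i (he h)))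
  · refine ⟨p 0, p' 0, p 1, p' 1, fun h => hpp 0 (he h), fun h => hpp 1 (he h), ?_⟩
    have h0 := hinner 0
    have h1 := hinner 1
    rw [pow_zero, one_mul] at h0
    have h := im_mul_mul_conj_eq_zero hu h0 h1
    rw [mul_assoc] at h ⊢
    simpa using him 1 _ h

end Finite

end DigitExpansion

lemma abs_tan_eq_one_of_rational {θ : ℝ} (hsin : Real.sin θ ≠ 0) (hcos : Real.cos θ ≠ 0)
    (hθ : ∃ r : ℚ, θ = r * Real.pi) {A B : ℚ} (hAB : A ≠ 0 ∨ B ≠ 0)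
    (h : B * Real.cos θ = A * Real.sin θ) : |Real.tan θ| = 1 := by
  obtain ⟨r, hr⟩ := hθ
  have h2θ : ∃ r : ℚ, 2 * θ = r * Real.pi := ⟨2 * r, by rw [hr]; push_cast; ring⟩
  have hsq := Real.sin_sq_add_cos_sq θ
  have hpos : (0 : ℚ) < A ^ 2 + B ^ 2 := by
    rcases hAB with h | h <;> positivity
  have hposR : (A : ℝ) ^ 2 + (B : ℝ) ^ 2 ≠ 0 := by exact_mod_cast hpos.ne'
  have hc := niven h2θ ⟨(A ^ 2 - B ^ 2) / (A ^ 2 + B ^ 2), by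
    push_cast
    rw [eq_div_iff hposR, Real.cos_two_mul]
    linear_combination (2 * (B * Real.cos θ + A * Real.sin θ)) * h + 2 * A ^ 2 * hsq⟩
  have hs := niven_sin h2θ ⟨2 * A * B / (A ^ 2 + B ^ 2), by
    push_cast
    rw [eq_div_iff hposR, Real.sin_two_mul]
    linear_combination
      (2 * B * Real.sin θ - 2 * A * Real.cos θ) * h + 2 * A * B * hsq⟩
  have h2 := Real.sin_sq_add_cos_sq (2 * θ)
  have hs0 : Real.sin (2 * θ) ≠ 0 := by
    rw [Real.sin_two_mul]; positivity
  have hc0 : Real.cos (2 * θ) = 0 := by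
    simp only [Set.mem_insert_iff, Set.mem_singleton_iff] at hc hs
    rcases hc with hc | hc | hc | hc | hc <;> rcases hs with hs | hs | hs | hs | hs <;>
      first | exact hc | exact absurd hs hs0 | (rw [hc, hs] at h2; norm_num at h2)
  rw [Real.cos_two_mul'] at hc0
  rw [Real.tan_eq_sin_div_cos, abs_div, div_eq_one_iff_eq (abs_ne_zero.2 hcos)]
  exact (sq_eq_sq_iff_abs_eq_abs _ _).1 (by linarith)

lemma abs_tan_eq_one_of_im_eq_zero {θ lam : ℝ} (hlam : 0 < lam) (hsin : Real.sin θ ≠ 0)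
    (hcos : Real.cos θ ≠ 0) {w : ℂ} (hw : w = lam * Complex.exp (θ * Complex.I)) {m : ℕ}
    (hm : 0 < m) (hpow : (w⁻¹ ^ m).im = 0) {z : ℂ} (hz : z ≠ 0) {A B : ℤ} (hre : z.re = A)
    (him : z.im = B) (h : (w⁻¹ * z).im = 0) : |Real.tan θ| = 1 := by
  have hwre : w.re = lam * Real.cos θ := by
    simp [hw, Complex.exp_ofReal_mul_I_re]
  have hwim : w.im = lam * Real.sin θ := by
    simp [hw, Complex.exp_ofReal_mul_I_im]
  have hw0 : w ≠ 0 := by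
    intro h0
    rw [h0, Complex.zero_re] at hwre
    exact mul_ne_zero hlam.ne' hcos hwre.symm
  have hmθ : Real.sin (m * θ) = 0 := by
    have h1 : w ^ m = (lam ^ m : ℝ) * Complex.exp ((m * θ : ℝ) * Complex.I) := by
      rw [hw, mul_pow, ← Complex.exp_nat_mul]; push_cast; ring_nf
    rw [inv_pow, Complex.inv_im, div_eq_zero_iff, neg_eq_zero, h1, Complex.im_ofReal_mul,
      Complex.exp_ofReal_mul_I_im] at hpow
    rcases hpow with h2 | h2
    · exact (mul_eq_zero.1 h2).resolve_left (pow_pos hlam m).ne'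
    · rw [← h1] at h2
      exact absurd (Complex.normSq_eq_zero.1 h2) (pow_ne_zero m hw0)
  obtain ⟨k, hk⟩ := Real.sin_eq_zero_iff.1 hmθ
  have hm0 : (m : ℝ) ≠ 0 := by exact_mod_cast hm.ne'
  refine abs_tan_eq_one_of_rational hsin hcos (A := A) (B := B)
    ⟨k / m, by push_cast; field_simp; linarith⟩ ?_ ?_
  · by_contra! hcon
    refine hz (Complex.ext ?_ ?_)
    · rw [hre]; exact_mod_cast hcon.1
    · rw [him]; exact_mod_cast hcon.2
  · have h1 : (w⁻¹ * z).re * lam * Real.cos θ = A ∧ (w⁻¹ * z).re * lam * Real.sin θ = B := by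
      have h2 : z = w⁻¹ * z * w := by field_simp
      have h3 := congrArg Complex.re h2
      have h4 := congrArg Complex.im h2
      rw [Complex.mul_re, h, hre, hwre] at h3
      rw [Complex.mul_im, h, him, hwim] at h4
      constructor <;> linarith
    push_cast
    rw [← h1.1, ← h1.2]
    ring

open DigitExpansion in
lemma mem_BMCarpet_iff {n : ℕ} (hn : 2 ≤ n) {Λ : Finset (ℕ × ℕ)} {p : ℝ × ℝ} :
    p ∈ BMCarpet n n Λ ↔ ∃ x : ℕ → Λ,
      point (fun d : Λ => (⟨d.1.1, d.1.2⟩ : ℂ)) n x = ⟨p.1, p.2⟩ := by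
  set e : Λ → ℂ := fun d => ⟨d.1.1, d.1.2⟩
  have hcoord : ∀ x : ℕ → Λ, (point e n x).re = ∑' k : ℕ, ((x k).1.1 : ℝ) / (n : ℝ) ^ (k + 1) ∧
      (point e n x).im = ∑' k : ℕ, ((x k).1.2 : ℝ) / (n : ℝ) ^ (k + 1) := fun x => by
    have hx := summable_point e hn x
    constructor
    · rw [point, Complex.re_tsum hx]
      refine tsum_congr fun k => ?_
      rw [← Nat.cast_pow, ← Nat.cast_pow, Complex.div_natCast_re]
    · rw [point, Complex.im_tsum hx]
      refine tsum_congr fun k => ?_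
      rw [← Nat.cast_pow, ← Nat.cast_pow, Complex.div_natCast_im]
  constructor
  · rintro ⟨d, hd, h1, h2⟩
    refine ⟨fun k => ⟨d k, hd k⟩, Complex.ext ?_ ?_⟩
    · exact (hcoord _).1.trans h1.symm
    · exact (hcoord _).2.trans h2.symm
  · rintro ⟨x, hx⟩
    refine ⟨fun k => x k, fun k => (x k).2, ?_, ?_⟩
    · rw [← (hcoord x).1, hx]
    · rw [← (hcoord x).2, hx]

open DigitExpansion in
lemma StrongSep.injective_point {n : ℕ} (hn : 2 ≤ n) {Λ : Finset (ℕ × ℕ)}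
    (h : StrongSep n Λ) :
    Function.Injective (point (fun d : Λ => (⟨d.1.1, d.1.2⟩ : ℂ)) n) := by
  set e : Λ → ℂ := fun d => ⟨d.1.1, d.1.2⟩ with he
  have hn0 : (n : ℂ) ≠ 0 := by exact_mod_cast (by omega : n ≠ 0)
  have hmem : ∀ x : ℕ → Λ, ((point e n x).re, (point e n x).im) ∈
      sierpMap n (x 0) '' BMCarpet n n Λ := fun x => by
    refine ⟨((point e n (shift 1 x)).re, (point e n (shift 1 x)).im),
      (mem_BMCarpet_iff hn).2 ⟨shift 1 x, rfl⟩, ?_⟩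
    rw [point_eq_div e hn x, Complex.div_natCast_re, Complex.div_natCast_im]
    simp only [sierpMap, he, Complex.add_re, Complex.add_im, add_comm]
  intro x y hxy
  by_contra hne
  obtain ⟨l, hl⟩ := Function.ne_iff.1 hne
  obtain ⟨k, -, hk, hkne⟩ := ne_of_not_eqOn
    (fun hE : Set.EqOn x y (Set.Iio (l + 1)) => hl (hE (Set.mem_Iio.2 l.lt_succ_self)))
  have h1 := point_sub_of_eqOn e hn hk
  rw [hxy, sub_self, eq_comm, div_eq_zero_iff, or_iff_left (pow_ne_zero k hn0),
    sub_eq_zero] at h1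
  have hdis := h _ (shift k x 0).2 _ (shift k y 0).2
    (fun heq => hkne (by simpa [shift] using Subtype.ext heq))
  exact Set.disjoint_left.1 hdis (hmem (shift k x)) (h1 ▸ hmem (shift k y))

theorem oblique_rotation_tan_eq_one
    (n : ℕ) (Λ : Finset (ℕ × ℕ))
    (hn : 2 ≤ n)
    (hΛsub : Λ ⊆ Finset.range n ×ˢ Finset.range n)
    (hΛ1 : 1 < Λ.card) (hΛ2 : Λ.card < n * n)
    (hssc : StrongSep n Λ)
    (θ lam : ℝ) (a : ℝ × ℝ) (hlam : 0 < lam)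
    (f : ℝ × ℝ → ℝ × ℝ)
    (hfdef : ∀ p : ℝ × ℝ, f p =
      (lam * (Real.cos θ * p.1 - Real.sin θ * p.2) + a.1,
       lam * (Real.sin θ * p.1 + Real.cos θ * p.2) + a.2))
    (hsin : Real.sin θ ≠ 0) (hcos : Real.cos θ ≠ 0)
    (hsub : f '' BMCarpet n n Λ ⊆ BMCarpet n n Λ) :
    |Real.tan θ| = 1 := by
  set e : Λ → ℂ := fun d => ⟨d.1.1, d.1.2⟩ with he
  have hinj := hssc.injective_point hn
  have : Nontrivial Λ :=
    Fintype.one_lt_card_iff_nontrivial.1 (by simpa using hΛ1)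
  set w : ℂ := lam * Complex.exp (θ * Complex.I) with hw
  have hw0 : w ≠ 0 := mul_ne_zero (by exact_mod_cast hlam.ne') (Complex.exp_ne_zero _)
  have hlift : ∀ x : ℕ → Λ, ∃ y : ℕ → Λ,
      DigitExpansion.point e n y = w * DigitExpansion.point e n x + ⟨a.1, a.2⟩ := fun x => by
    set z := DigitExpansion.point e n x with hz
    obtain ⟨y, hy⟩ := (mem_BMCarpet_iff hn).1
      (hsub ⟨(z.re, z.im), (mem_BMCarpet_iff hn).2 ⟨x, rfl⟩, rfl⟩)
    refine ⟨y, hy.trans ?_⟩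
    rw [hfdef]
    apply Complex.ext <;>
      simp [hw, Complex.exp_ofReal_mul_I_re, Complex.exp_ofReal_mul_I_im, Complex.mul_re,
        Complex.mul_im] <;> ring
  choose F hF using hlift
  obtain ⟨⟨m, hm, hpow⟩, d₀, d₀', d₁, d₁', h₀, h₁, him⟩ :=
    DigitExpansion.exists_im_eq_zero e hn hinj hw0 hF
  rw [mul_assoc] at him
  refine abs_tan_eq_one_of_im_eq_zero hlam hsin hcos hw hm hpow
    (mul_ne_zero (sub_ne_zero.2 h₀)
      ((map_ne_zero (starRingEnd ℂ)).2 (sub_ne_zero.2 h₁)))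
    (A := (d₀.1.1 - d₀'.1.1) * (d₁.1.1 - d₁'.1.1) + (d₀.1.2 - d₀'.1.2) * (d₁.1.2 - d₁'.1.2))
    (B := (d₀.1.2 - d₀'.1.2) * (d₁.1.1 - d₁'.1.1) - (d₀.1.1 - d₀'.1.1) * (d₁.1.2 - d₁'.1.2))
    ?_ ?_ him <;>
  · simp [he]
    ring
end

section
/- Let K = K(n,m,Λ) be a Bedford–McMullen carpet (n > m ≥ 2) that is not contained in any affine line of ℝ², and suppose log n / log m is irrational. If f is a similitude on ℝ² with positive similarity ratio such that f(K) ⊆ K, then f is not oblique. -/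
open scoped BigOperators

section DigitSeries

lemma summable_digits {b : ℕ} (hb : 2 ≤ b) {d : ℕ → ℕ} (hd : ∀ k, d k < b) :
    Summable fun k : ℕ => (d k : ℝ) / (b : ℝ) ^ (k + 1) := by
  have hb' : (2 : ℝ) ≤ b := by exact_mod_cast hb
  have hs : Summable fun k : ℕ => ((b : ℝ)⁻¹) ^ k :=
    summable_geometric_of_lt_one (by positivity) (inv_lt_one_of_one_lt₀ (by linarith))
  refine hs.of_nonneg_of_le (fun k => by positivity) fun k => ?_
  have : (d k : ℝ) ≤ b := by exact_mod_cast (hd k).le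
  rw [pow_succ, inv_pow, div_le_iff₀ (by positivity)]
  field_simp
  exact this

lemma tsum_digits_nonneg {b : ℕ} {d : ℕ → ℕ} :
    0 ≤ ∑' k : ℕ, (d k : ℝ) / (b : ℝ) ^ (k + 1) :=
  tsum_nonneg fun k => by positivity

lemma tsum_digits_le_one {b : ℕ} (hb : 2 ≤ b) {d : ℕ → ℕ} (hd : ∀ k, d k < b) :
    ∑' k : ℕ, (d k : ℝ) / (b : ℝ) ^ (k + 1) ≤ 1 := by
  have hb' : (2 : ℝ) ≤ b := by exact_mod_cast hb
  have hg := (hasSum_geometric_of_lt_one (r := (b : ℝ)⁻¹) (by positivity)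
    (inv_lt_one_of_one_lt₀ (by linarith))).mul_left (((b : ℝ) - 1) / b)
  have h1 : ((b : ℝ) - 1) / b * (1 - (b : ℝ)⁻¹)⁻¹ = 1 := by
    have : (b : ℝ) - 1 ≠ 0 := by linarith
    field_simp
  rw [h1] at hg
  refine (summable_digits hb hd).tsum_le_of_sum_le ?_ |>.trans le_rfl
  intro s
  refine le_trans (Finset.sum_le_sum fun k _ => ?_) (sum_le_hasSum s (fun k _ => ?_) hg)
  · have : (d k : ℝ) + 1 ≤ b := by exact_mod_cast hd k
    rw [pow_succ, inv_pow, div_le_iff₀ (by positivity)]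
    field_simp
    linarith
  · have : (0 : ℝ) ≤ (b : ℝ) - 1 := by linarith
    positivity

lemma tsum_digits_eq {b : ℕ} (hb : 2 ≤ b) {d : ℕ → ℕ} (hd : ∀ k, d k < b) :
    ∑' k : ℕ, (d k : ℝ) / (b : ℝ) ^ (k + 1)
      = ((∑' k : ℕ, (d (k + 1) : ℝ) / (b : ℝ) ^ (k + 1)) + d 0) / b := by
  have hb' : (b : ℝ) ≠ 0 := by positivity
  rw [(summable_digits hb hd).tsum_eq_zero_add, add_div, ← tsum_div_const, add_comm]
  congr 1
  · refine tsum_congr fun k => ?_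
    rw [pow_succ _ (k + 1)]
    field_simp
  · simp

end DigitSeries

section Carpet

variable {n m : ℕ} {Λ : Finset (ℕ × ℕ)}

lemma BMCarpet.mem_unit (hn : 2 ≤ n) (hm : 2 ≤ m)
    (hΛ : Λ ⊆ Finset.range n ×ˢ Finset.range m) {p : ℝ × ℝ} (hp : p ∈ BMCarpet n m Λ) :
    (0 ≤ p.1 ∧ p.1 ≤ 1) ∧ 0 ≤ p.2 ∧ p.2 ≤ 1 := by
  obtain ⟨d, hd, h1, h2⟩ := hp
  have hd' := fun k => Finset.mem_product.1 (hΛ (hd k))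
  rw [h1, h2]
  exact ⟨⟨tsum_digits_nonneg, tsum_digits_le_one hn fun k => Finset.mem_range.1 (hd' k).1⟩,
    tsum_digits_nonneg, tsum_digits_le_one hm fun k => Finset.mem_range.1 (hd' k).2⟩

lemma BMCarpet.map_mem (hn : 2 ≤ n) (hm : 2 ≤ m)
    (hΛ : Λ ⊆ Finset.range n ×ˢ Finset.range m) {p : ℝ × ℝ} (hp : p ∈ BMCarpet n m Λ)
    {i j : ℕ} (hij : (i, j) ∈ Λ) : ((p.1 + i) / n, (p.2 + j) / m) ∈ BMCarpet n m Λ := by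
  obtain ⟨d, hd, h1, h2⟩ := hp
  have he : ∀ k, (fun k : ℕ => Nat.casesOn k (i, j) d : ℕ → ℕ × ℕ) k ∈ Λ := by
    rintro (_ | k)
    exacts [hij, hd k]
  have he' := fun k => Finset.mem_product.1 (hΛ (he k))
  refine ⟨_, he, ?_, ?_⟩
  · rw [tsum_digits_eq hn fun k => Finset.mem_range.1 (he' k).1, h1]
    rfl
  · rw [tsum_digits_eq hm fun k => Finset.mem_range.1 (he' k).2, h2]
    rfl

lemma BMCarpet.exists_eq_map (hn : 2 ≤ n) (hm : 2 ≤ m)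
    (hΛ : Λ ⊆ Finset.range n ×ˢ Finset.range m) {p : ℝ × ℝ} (hp : p ∈ BMCarpet n m Λ) :
    ∃ i j : ℕ, (i, j) ∈ Λ ∧ ∃ q ∈ BMCarpet n m Λ, p.1 = (q.1 + i) / n ∧ p.2 = (q.2 + j) / m := by
  obtain ⟨d, hd, h1, h2⟩ := hp
  have hd' := fun k => Finset.mem_product.1 (hΛ (hd k))
  refine ⟨(d 0).1, (d 0).2, hd 0,
    (∑' k : ℕ, ((d (k + 1)).1 : ℝ) / (n : ℝ) ^ (k + 1),
      ∑' k : ℕ, ((d (k + 1)).2 : ℝ) / (m : ℝ) ^ (k + 1)),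
    ⟨fun k => d (k + 1), fun k => hd _, rfl, rfl⟩, ?_, ?_⟩
  · rw [h1, tsum_digits_eq hn fun k => Finset.mem_range.1 (hd' k).1]
  · rw [h2, tsum_digits_eq hm fun k => Finset.mem_range.1 (hd' k).2]

/-- The integers with `t` base-`n` digits, all taken from `D`. -/
def digitNums (n : ℕ) (D : Finset ℕ) : ℕ → Finset ℕ
  | 0 => {0}
  | t + 1 => Finset.image₂ (fun d r => n * d + r) (digitNums n D t) D

/-- The integers `I` with `t` base-`n` digits such that, position by position, the digits of `I`
and the base-`m` digits of `J` form pairs in `Λ`. -/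
def rowNums (n m : ℕ) (Λ : Finset (ℕ × ℕ)) : ℕ → ℕ → Finset ℕ
  | 0, _ => {0}
  | t + 1, J => Finset.image₂ (fun d r => n * d + r) (rowNums n m Λ t (J / m))
      ((Λ.filter fun q => q.2 = J % m).image Prod.fst)

lemma card_rowNums_le {N : ℕ} (hN : ∀ j, ((Λ.filter fun q => q.2 = j).image Prod.fst).card ≤ N)
    (t J : ℕ) : (rowNums n m Λ t J).card ≤ N ^ t := by
  induction t generalizing J with
  | zero => simp [rowNums]
  | succ t ih =>
    rw [rowNums, pow_succ]
    exact (Finset.card_image₂_le _ _ _).trans (Nat.mul_le_mul (ih _) (hN _))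

lemma digitNums_lt {D : Finset ℕ} (hD : D ⊆ Finset.range n) {t d : ℕ}
    (hd : d ∈ digitNums n D t) : d < n ^ t := by
  induction t generalizing d with
  | zero => simp_all [digitNums]
  | succ t ih =>
    obtain ⟨a, ha, r, hr, rfl⟩ := Finset.mem_image₂.1 hd
    have h1 := ih ha
    have h2 := Finset.mem_range.1 (hD hr)
    rw [pow_succ]
    nlinarith

lemma mul_add_injective {b a r a' r' : ℕ} (hr : r < b) (hr' : r' < b)
    (h : b * a + r = b * a' + r') : a = a' ∧ r = r' := by
  have h1 : (b * a + r) / b = a := by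
    rw [Nat.mul_add_div (by omega), Nat.div_eq_of_lt hr, add_zero]
  have h2 : (b * a' + r') / b = a' := by
    rw [Nat.mul_add_div (by omega), Nat.div_eq_of_lt hr', add_zero]
  have h3 : a = a' := by rw [← h1, h, h2]
  subst h3
  exact ⟨rfl, by omega⟩

lemma card_digitNums {D : Finset ℕ} (hD : D ⊆ Finset.range n) (t : ℕ) :
    (digitNums n D t).card = D.card ^ t := by
  induction t with
  | zero => simp [digitNums]
  | succ t ih =>
    rw [digitNums, Finset.card_image₂_iff.2, ih, pow_succ]
    rintro ⟨a, r⟩ h ⟨a', r'⟩ h' heq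
    have hr := Finset.mem_range.1 (hD (Set.mem_prod.1 h).2)
    have hr' := Finset.mem_range.1 (hD (Set.mem_prod.1 h').2)
    obtain ⟨rfl, rfl⟩ := mul_add_injective hr hr' heq
    rfl

lemma digitNums_add {D : Finset ℕ} (t s : ℕ) :
    digitNums n D (t + s)
      = Finset.image₂ (fun d r => n ^ s * d + r) (digitNums n D t) (digitNums n D s) := by
  induction s with
  | zero => ext x; simp [digitNums]
  | succ s ih =>
    ext x
    rw [← add_assoc, digitNums, ih, digitNums]
    simp only [Finset.mem_image₂]
    constructor
    · rintro ⟨_, ⟨a, ha, b, hb, rfl⟩, r, hr, rfl⟩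
      exact ⟨a, ha, _, ⟨b, hb, r, hr, rfl⟩, by ring⟩
    · rintro ⟨a, ha, _, ⟨b, hb, r, hr, rfl⟩, rfl⟩
      exact ⟨_, ⟨a, ha, b, hb, rfl⟩, r, hr, by ring⟩

lemma BMCarpet.digitNums_mem (hn : 2 ≤ n) (hm : 2 ≤ m)
    (hΛ : Λ ⊆ Finset.range n ×ˢ Finset.range m) {D : Finset ℕ} {j : ℕ}
    (hD : ∀ i ∈ D, (i, j) ∈ Λ) (t : ℕ) :
    ∃ Y : ℝ, ∀ d ∈ digitNums n D t, ∀ p ∈ BMCarpet n m Λ,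
      ((p.1 + d) / (n : ℝ) ^ t, (p.2 + Y) / (m : ℝ) ^ t) ∈ BMCarpet n m Λ := by
  have hn0 : (n : ℝ) ≠ 0 := by positivity
  have hm0 : (m : ℝ) ≠ 0 := by positivity
  induction t with
  | zero =>
    refine ⟨0, fun d hd p hp => ?_⟩
    have : d = 0 := by simpa [digitNums] using hd
    simpa [this] using hp
  | succ t ih =>
    obtain ⟨Y, hY⟩ := ih
    refine ⟨m * Y + j, fun d hd p hp => ?_⟩
    obtain ⟨a, ha, r, hr, rfl⟩ := Finset.mem_image₂.1 hd
    convert hY a ha _ (BMCarpet.map_mem hn hm hΛ hp (hD r hr)) using 2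
    · push_cast
      rw [pow_succ]
      field_simp
      ring
    · rw [pow_succ]
      field_simp
      ring

lemma BMCarpet.exists_rowNums (hn : 2 ≤ n) (hm : 2 ≤ m)
    (hΛ : Λ ⊆ Finset.range n ×ˢ Finset.range m) (t : ℕ) {p : ℝ × ℝ} (hp : p ∈ BMCarpet n m Λ) :
    ∃ I J : ℕ, I ∈ rowNums n m Λ t J ∧ J < m ^ t ∧ ∃ q ∈ BMCarpet n m Λ,
      (n : ℝ) ^ t * p.1 = I + q.1 ∧ (m : ℝ) ^ t * p.2 = J + q.2 := by
  have hn0 : (n : ℝ) ≠ 0 := by positivity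
  have hm0 : (m : ℝ) ≠ 0 := by positivity
  induction t with
  | zero => exact ⟨0, 0, by simp [rowNums], by simp, p, hp, by simp, by simp⟩
  | succ t ih =>
    obtain ⟨I, J, hI, hJ, q, hq, h1, h2⟩ := ih
    obtain ⟨i, j, hij, r, hr, h3, h4⟩ := BMCarpet.exists_eq_map hn hm hΛ hq
    have hj : j < m := Finset.mem_range.1 (Finset.mem_product.1 (hΛ hij)).2
    refine ⟨n * I + i, m * J + j, ?_, ?_, r, hr, ?_, ?_⟩
    · rw [rowNums, Nat.mul_add_div (by omega), Nat.div_eq_of_lt hj, Nat.mul_add_mod,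
        Nat.mod_eq_of_lt hj]
      exact Finset.mem_image₂_of_mem hI (Finset.mem_image.2 ⟨(i, j), by simp [hij], rfl⟩)
    · rw [pow_succ]
      nlinarith
    · rw [pow_succ, mul_comm ((n : ℝ) ^ t), mul_assoc, h1, h3]
      push_cast
      field_simp
      ring
    · rw [pow_succ, mul_comm ((m : ℝ) ^ t), mul_assoc, h2, h4]
      push_cast
      field_simp
      ring

end Carpet

section Overlap

lemma false_of_neg_step {X : Set ℝ} (hne : X.Nonempty) (hper : ∀ x ∈ X, ∀ z : ℤ, x + z ∈ X)
    {g δ η w : ℝ} (hgap : ∀ x ∈ X, x < g + δ → x ≤ g)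
    (hstep : ∀ x ∈ X, ∃ x' ∈ X, |x - x' - w| ≤ η) (h1 : η < -w)
    (h2 : -w + η < δ) : False := by
  obtain ⟨x₀, hx₀⟩ := hne
  have key : ∀ k : ℕ, ∃ x ∈ X, x ≤ g ∧ x₀ + ⌊g - x₀⌋ + k * (-w - η) ≤ x := by
    intro k
    induction k with
    | zero =>
      refine ⟨_, hper x₀ hx₀ ⌊g - x₀⌋, ?_, by simp⟩
      linarith [Int.floor_le (g - x₀)]
    | succ k ih =>
      obtain ⟨x, hx, hxg, hxk⟩ := ih
      obtain ⟨x', hx', h⟩ := hstep x hx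
      have := abs_le.1 h
      refine ⟨x', hx', hgap x' hx' (by linarith), ?_⟩
      push_cast
      linarith
  obtain ⟨k, hk⟩ := exists_nat_gt ((g - (x₀ + ⌊g - x₀⌋)) / (-w - η))
  rw [div_lt_iff₀ (by linarith)] at hk
  obtain ⟨x, -, hxg, hxk⟩ := key k
  linarith

/-- A nonempty `ℤ`-periodic set with a gap of length `δ` is not approximately contained in its
translate by a small but not too small vector. -/
lemma false_of_step {X : Set ℝ} (hne : X.Nonempty) (hper : ∀ x ∈ X, ∀ z : ℤ, x + z ∈ X)
    {g δ η w : ℝ} (hgap : ∀ x ∈ X, g < x → g + δ ≤ x)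
    (hstep : ∀ x ∈ X, ∃ x' ∈ X, |x - x' - w| ≤ η) (h1 : η < |w|)
    (h2 : |w| + η < δ) : False := by
  rcases lt_or_ge w 0 with hw | hw
  · rw [abs_of_neg hw] at h1 h2
    exact false_of_neg_step hne hper
      (fun x hx hxg => not_lt.1 fun h => hxg.not_ge (hgap x hx h)) hstep h1 h2
  · rw [abs_of_nonneg hw] at h1 h2
    refine false_of_neg_step (X := -X) (g := -(g + δ)) (δ := δ) (w := -w) (η := η) hne.neg
      (fun x hx z => ?_) (fun x hx hxg => ?_) (fun x hx => ?_) (by linarith) (by linarith)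
    · have := hper _ hx (-z)
      rw [Set.mem_neg]
      convert this using 1
      push_cast
      ring
    · have := hgap (-x) hx (by linarith)
      linarith
    · obtain ⟨x', hx', h⟩ := hstep (-x) hx
      refine ⟨-x', by simpa using hx', ?_⟩
      rw [← abs_neg]
      convert h using 2
      ring

lemma iterate_step {X : Set ℝ} {η v : ℝ} (hstep : ∀ x ∈ X, ∃ x' ∈ X, |x - x' - v| ≤ η) (k : ℕ) :
    ∀ x ∈ X, ∃ x' ∈ X, |x - x' - k * v| ≤ k * η := by
  induction k with
  | zero => exact fun x hx => ⟨x, hx, by simp⟩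
  | succ k ih =>
    intro x hx
    obtain ⟨y, hy, h1⟩ := ih x hx
    obtain ⟨z, hz, h2⟩ := hstep y hy
    refine ⟨z, hz, ?_⟩
    push_cast
    rw [abs_le] at *
    constructor <;> linarith

lemma exists_near_int_of_step {X : Set ℝ} (hne : X.Nonempty)
    (hper : ∀ x ∈ X, ∀ z : ℤ, x + z ∈ X) {n : ℕ} (hn : 0 < n) {g η v : ℝ}
    (hgap : ∀ x ∈ X, g < x → g + 1 / n ≤ x)
    (hstep : ∀ x ∈ X, ∃ x' ∈ X, |x - x' - v| ≤ η) (hη : 0 ≤ η) :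
    ∃ z : ℤ, |((2 * n).factorial : ℝ) * v - z| ≤ (2 * n).factorial * (2 * n * η) := by
  obtain ⟨k, hk0, hkn, hk⟩ := Real.exists_nat_abs_mul_sub_round_le v (n := 2 * n) (by omega)
  set z := round (k * v)
  have hn' : (0 : ℝ) < n := by exact_mod_cast hn
  have hkn' : (k : ℝ) ≤ 2 * n := by exact_mod_cast hkn
  have hkey : |k * v - z| ≤ 2 * n * η := by
    by_contra! hcon
    refine false_of_step hne hper hgap (w := k * v - z) (η := 2 * n * η) (fun x hx => ?_)
      hcon ?_
    · obtain ⟨x', hx', h⟩ := iterate_step hstep k x hx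
      refine ⟨x' + z, hper x' hx' z, ?_⟩
      have h' : (k : ℝ) * η ≤ 2 * n * η := by gcongr
      refine le_trans (le_of_eq ?_) (h.trans h')
      congr 1
      ring
    · have h3 : 2 * (1 / (((2 * n : ℕ) : ℝ) + 1)) < 1 / n := by
        push_cast
        rw [mul_one_div, div_lt_div_iff₀ (by positivity) hn']
        linarith
      linarith
  obtain ⟨q, hq⟩ := Nat.dvd_factorial hk0 hkn
  refine ⟨q * z, ?_⟩
  have hq1 : (q : ℝ) ≤ (2 * n).factorial := by
    rw [hq]
    exact_mod_cast Nat.le_mul_of_pos_left q hk0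
  have : ((2 * n).factorial : ℝ) * v - ((q * z : ℤ) : ℝ) = q * (k * v - z) := by
    rw [hq]
    push_cast
    ring
  rw [this, abs_mul, Nat.abs_cast]
  gcongr

/-- If `c` is irrational then `L n ^ t c` is not eventually close to the integers. -/
lemma Irrational.exists_far_from_int {c : ℝ} (hc : Irrational c) {n L : ℕ} (hn : 2 ≤ n)
    (hL : 0 < L) (t₀ : ℕ) :
    ∃ t ≥ t₀, ∀ z : ℤ, 1 / (2 * n : ℝ) ≤ |(L : ℝ) * ((n : ℝ) ^ t * c) - z| := by
  by_contra! hcon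
  have hn' : (2 : ℝ) ≤ n := by exact_mod_cast hn
  have hn0 : (0 : ℝ) < 1 / (2 * n) := by positivity
  obtain ⟨z, hz⟩ := hcon t₀ le_rfl
  have key : ∀ k : ℕ, |(L : ℝ) * ((n : ℝ) ^ (t₀ + k) * c) - ((n ^ k * z : ℤ) : ℝ)| < 1 / (2 * n) := by
    intro k
    induction k with
    | zero => simpa using hz
    | succ k ih =>
      obtain ⟨z', hz'⟩ := hcon (t₀ + (k + 1)) (by omega)
      have hlt : (n : ℝ) * (1 / (2 * n)) = 1 / 2 := by field_simp
      have hle : 1 / (2 * n : ℝ) ≤ 1 / 4 := by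
        apply one_div_le_one_div_of_le <;> linarith
      have h1 : |(L : ℝ) * ((n : ℝ) ^ (t₀ + (k + 1)) * c) - ((n ^ (k + 1) * z : ℤ) : ℝ)| < 1 / 2 := by
        have : (L : ℝ) * ((n : ℝ) ^ (t₀ + (k + 1)) * c) - ((n ^ (k + 1) * z : ℤ) : ℝ)
            = n * ((L : ℝ) * ((n : ℝ) ^ (t₀ + k) * c) - ((n ^ k * z : ℤ) : ℝ)) := by
          push_cast
          ring
        rw [this, abs_mul, Nat.abs_cast, ← hlt]
        gcongr
      have h2 : z' = (n : ℤ) ^ (k + 1) * z := by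
        have : |((z' - (n : ℤ) ^ (k + 1) * z : ℤ) : ℝ)| < 1 := by
          rw [abs_lt] at *
          push_cast at *
          constructor <;> linarith
        have h3 : |z' - (n : ℤ) ^ (k + 1) * z| < 1 := by exact_mod_cast this
        linarith [Int.abs_lt_one_iff.1 h3]
      rwa [h2] at hz'
  have hzero : (L : ℝ) * ((n : ℝ) ^ t₀ * c) - z = 0 := by
    by_contra hne
    obtain ⟨k, hk⟩ := pow_unbounded_of_one_lt (1 / |(L : ℝ) * ((n : ℝ) ^ t₀ * c) - z|)
      (show (1 : ℝ) < n by linarith)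
    rw [div_lt_iff₀ (abs_pos.2 hne)] at hk
    have h1 := key k
    have h2 : (L : ℝ) * ((n : ℝ) ^ (t₀ + k) * c) - ((n ^ k * z : ℤ) : ℝ)
        = (n : ℝ) ^ k * ((L : ℝ) * ((n : ℝ) ^ t₀ * c) - z) := by
      push_cast
      ring
    rw [h2, abs_mul, abs_of_nonneg (by positivity : (0 : ℝ) ≤ (n : ℝ) ^ k)] at h1
    have : 1 / (2 * n : ℝ) ≤ 1 := by
      rw [div_le_one (by positivity)]
      linarith
    linarith
  refine hc ⟨(z : ℚ) / (L * n ^ t₀), ?_⟩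
  have hL' : (L : ℝ) ≠ 0 := by positivity
  push_cast
  field_simp
  linarith

variable {n : ℕ} {D : Finset ℕ} {c R : ℝ}

open Classical in
/-- The elements of `digitNums n D t` lying within `R` of their translate by `n ^ t * c`. -/
noncomputable def overlap (n : ℕ) (D : Finset ℕ) (c R : ℝ) (t : ℕ) : Finset ℕ :=
  (digitNums n D t).filter fun d => ∃ e ∈ digitNums n D t, |(d : ℝ) - e - (n : ℝ) ^ t * c| ≤ R

lemma mem_overlap {t d : ℕ} : d ∈ overlap n D c R t ↔
    d ∈ digitNums n D t ∧ ∃ e ∈ digitNums n D t, |(d : ℝ) - e - (n : ℝ) ^ t * c| ≤ R := by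
  simp [overlap]

lemma exists_of_mem_overlap_add (hD : D ⊆ Finset.range n) (hR : 1 ≤ R) {t s x : ℕ}
    (hx : x ∈ overlap n D c R (t + s)) :
    ∃ d ∈ overlap n D c R t, ∃ r ∈ digitNums n D s, n ^ s * d + r = x := by
  obtain ⟨hx, e, he, h⟩ := mem_overlap.1 hx
  rw [digitNums_add] at hx he
  obtain ⟨d, hd, r, hr, rfl⟩ := Finset.mem_image₂.1 hx
  obtain ⟨d', hd', r', hr', rfl⟩ := Finset.mem_image₂.1 he
  refine ⟨d, mem_overlap.2 ⟨hd, d', hd', ?_⟩, r, hr, rfl⟩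
  have h1 : (r : ℝ) + 1 ≤ (n : ℝ) ^ s := by exact_mod_cast digitNums_lt hD hr
  have h2 : (r' : ℝ) + 1 ≤ (n : ℝ) ^ s := by exact_mod_cast digitNums_lt hD hr'
  have hr0 : (0 : ℝ) ≤ r := by positivity
  have hr0' : (0 : ℝ) ≤ r' := by positivity
  have hP : (1 : ℝ) ≤ (n : ℝ) ^ s := by linarith
  rw [pow_add] at h
  push_cast at h
  set P := (n : ℝ) ^ s
  rw [abs_le] at h ⊢
  have h3 : P * (d - d' - (n : ℝ) ^ t * c) ≤ P * R := by nlinarith [h.2]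
  have h4 : P * (-R) ≤ P * (d - d' - (n : ℝ) ^ t * c) := by nlinarith [h.1]
  exact ⟨le_of_mul_le_mul_left h4 (by linarith), le_of_mul_le_mul_left h3 (by linarith)⟩

open Classical in
lemma card_overlap_add_le (hD : D ⊆ Finset.range n) (hR : 1 ≤ R) {t s B : ℕ}
    (hB : ∀ d ∈ overlap n D c R t,
      ((digitNums n D s).filter fun r => n ^ s * d + r ∈ overlap n D c R (t + s)).card ≤ B) :
    (overlap n D c R (t + s)).card ≤ (overlap n D c R t).card * B := by
  refine (Finset.card_le_card ?_).trans (Finset.card_biUnion_le_card_mul (overlap n D c R t)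
    (fun d => ((digitNums n D s).filter fun r =>
      n ^ s * d + r ∈ overlap n D c R (t + s)).image fun r => n ^ s * d + r) B
    fun d hd => Finset.card_image_le.trans (hB d hd))
  intro x hx
  obtain ⟨d, hd, r, hr, rfl⟩ := exists_of_mem_overlap_add hD hR hx
  exact Finset.mem_biUnion.2 ⟨d, hd, Finset.mem_image.2 ⟨r, Finset.mem_filter.2 ⟨hr, hx⟩, rfl⟩⟩

/-- If all descendants at depth `s` of some element of the overlap stay in the overlap, then a
fixed multiple of `n ^ t * c` is close to an integer. -/
lemma exists_near_int_of_full (hn : 2 ≤ n) (hD : D ⊆ Finset.range n) (hDne : D.Nonempty)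
    (hDn : D.card < n) (hR : 0 ≤ R) {t s d : ℕ}
    (h : ∀ r ∈ digitNums n D (1 + s), n ^ (1 + s) * d + r ∈ overlap n D c R (t + (1 + s))) :
    ∃ z : ℤ, |((2 * n).factorial : ℝ) * ((n : ℝ) ^ t * c) - z|
      ≤ (2 * n).factorial * (2 * n * (R / (n : ℝ) ^ (1 + s))) := by
  obtain ⟨i₀, hi₀, hi₀D⟩ : ∃ i ∈ Finset.range n, i ∉ D := by
    by_contra! hcon
    exact absurd (Finset.card_le_card hcon) (by simpa using hDn)
  have hi₀ := Finset.mem_range.1 hi₀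
  have hn0 : (0 : ℝ) < n := by positivity
  refine exists_near_int_of_step
    (X := {x | ∃ r ∈ digitNums n D (1 + s), ∃ z : ℤ, x = r / (n : ℝ) ^ (1 + s) + z})
    (g := i₀ / n) ?_ ?_ (by omega) ?_ ?_ (by positivity)
  · have : (digitNums n D (1 + s)).Nonempty := by
      rw [← Finset.card_pos, card_digitNums hD]
      have := hDne.card_pos
      positivity
    obtain ⟨r, hr⟩ := this
    exact ⟨_, r, hr, 0, rfl⟩
  · rintro _ ⟨r, hr, z, rfl⟩ z'
    exact ⟨r, hr, z + z', by push_cast; ring⟩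
  · rintro _ ⟨r, hr, z, rfl⟩ hlt
    rw [digitNums_add] at hr
    obtain ⟨a, ha, b, hb, rfl⟩ := Finset.mem_image₂.1 hr
    replace ha : a ∈ D := by simpa [digitNums] using ha
    have han := Finset.mem_range.1 (hD ha)
    have hb1 : (b : ℝ) < (n : ℝ) ^ s := by exact_mod_cast digitNums_lt hD hb
    have hP : (0 : ℝ) < (n : ℝ) ^ s := by positivity
    have heq : ((n ^ s * a + b : ℕ) : ℝ) / (n : ℝ) ^ (1 + s) + z
        = (n * z + a + b / (n : ℝ) ^ s) / n := by
      rw [pow_add]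
      push_cast
      field_simp
      ring
    have hβ1 : (b : ℝ) / (n : ℝ) ^ s < 1 := (div_lt_one hP).2 hb1
    have hβ0 : 0 ≤ (b : ℝ) / (n : ℝ) ^ s := by positivity
    rw [heq] at hlt ⊢
    rw [← add_div, div_le_div_iff_of_pos_right hn0]
    rw [div_lt_div_iff_of_pos_right hn0] at hlt
    have h1 : (i₀ : ℤ) < n * z + a + 1 := by
      have : (i₀ : ℝ) < n * z + a + 1 := by linarith
      exact_mod_cast this
    have h2 : (i₀ : ℤ) ≠ n * z + a := by
      intro hcon
      have : z = 0 := by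
        have hz1 : -1 < z := by nlinarith
        have hz2 : z < 1 := by nlinarith
        omega
      subst this
      apply hi₀D
      have : i₀ = a := by simpa using hcon
      rwa [this]
    have h3 : (i₀ : ℝ) + 1 ≤ n * z + a := by
      have : (i₀ : ℤ) + 1 ≤ n * z + a := by omega
      exact_mod_cast this
    linarith
  · rintro _ ⟨r, hr, z, rfl⟩
    obtain ⟨-, e, he, habs⟩ := mem_overlap.1 (h r hr)
    rw [digitNums_add] at he
    obtain ⟨d', hd', r', hr', rfl⟩ := Finset.mem_image₂.1 he
    refine ⟨_, ⟨r', hr', d' - d + z, rfl⟩, ?_⟩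
    rw [le_div_iff₀ (by positivity), ← abs_of_pos (by positivity : (0 : ℝ) < (n : ℝ) ^ (1 + s)),
      ← abs_mul, abs_of_pos (by positivity : (0 : ℝ) < (n : ℝ) ^ (1 + s))]
    refine le_trans (le_of_eq ?_) habs
    congr 1
    push_cast
    rw [pow_add _ t]
    field_simp
    ring

/-- For irrational `c` the proportion of the overlap tends to zero. -/
lemma exists_card_overlap_le (hn : 2 ≤ n) (hD : D ⊆ Finset.range n) (hDne : D.Nonempty)
    (hDn : D.card < n) (hR : 1 ≤ R) (hc : Irrational c) {ε : ℝ} (hε : 0 < ε) :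
    ∃ t₀, ∀ t ≥ t₀, ((overlap n D c R t).card : ℝ) ≤ ε * (D.card : ℝ) ^ t := by
  classical
  have hn' : (2 : ℝ) ≤ n := by exact_mod_cast hn
  have hN : (0 : ℝ) < D.card := by exact_mod_cast hDne.card_pos
  have hmono : ∀ t s, ((overlap n D c R (t + s)).card : ℝ)
      ≤ (overlap n D c R t).card * (D.card : ℝ) ^ s := by
    intro t s
    have := card_overlap_add_le (c := c) (t := t) (s := s) (B := D.card ^ s) hD hR
      fun d _ => (Finset.card_filter_le _ _).trans (card_digitNums hD s).le
    exact_mod_cast this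
  obtain ⟨s, hs⟩ := pow_unbounded_of_one_lt
    (((2 * n).factorial : ℝ) * (2 * n * R) * (2 * n)) (show (1 : ℝ) < n by linarith)
  have hs' : ((2 * n).factorial : ℝ) * (2 * n * (R / (n : ℝ) ^ (1 + s))) < 1 / (2 * n) := by
    have : (n : ℝ) ^ s ≤ (n : ℝ) ^ (1 + s) := pow_le_pow_right₀ (by linarith) (by omega)
    rw [lt_div_iff₀ (by positivity)]
    have heq : ((2 * n).factorial : ℝ) * (2 * n * (R / (n : ℝ) ^ (1 + s))) * (2 * n)
        = ((2 * n).factorial : ℝ) * (2 * n * R) * (2 * n) / (n : ℝ) ^ (1 + s) := by ring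
    rw [heq, div_lt_one (by positivity)]
    linarith
  have hloss : ∀ t₀, ∃ t ≥ t₀, ((overlap n D c R (t + (1 + s))).card : ℝ)
      ≤ (overlap n D c R t).card * ((D.card : ℝ) ^ (1 + s) - 1) := by
    intro t₀
    obtain ⟨t, ht, hfar⟩ := hc.exists_far_from_int hn (Nat.factorial_pos (2 * n)) t₀
    refine ⟨t, ht, ?_⟩
    have := card_overlap_add_le (c := c) (t := t) (s := 1 + s) (B := D.card ^ (1 + s) - 1) hD hR
      fun d hd => ?_
    · have h1 : 1 ≤ D.card ^ (1 + s) := Nat.one_le_pow _ _ hDne.card_pos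
      have h2 : (((overlap n D c R t).card * (D.card ^ (1 + s) - 1) : ℕ) : ℝ)
          = (overlap n D c R t).card * ((D.card : ℝ) ^ (1 + s) - 1) := by
        push_cast [h1]
        ring
      rw [← h2]
      exact_mod_cast this
    · rw [← card_digitNums hD]
      refine Nat.le_sub_one_of_lt (Finset.card_lt_card (Finset.filter_ssubset.2 ?_))
      by_contra! hcon
      obtain ⟨z, hz⟩ := exists_near_int_of_full hn hD hDne hDn (by linarith) hcon
      linarith [hfar z]
  set θ : ℝ := 1 - 1 / (D.card : ℝ) ^ (1 + s) with hθ
  have hNs : (1 : ℝ) ≤ (D.card : ℝ) ^ (1 + s) :=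
    one_le_pow₀ (by exact_mod_cast hDne.card_pos)
  have hθ0 : 0 ≤ θ := by
    have : 1 / (D.card : ℝ) ^ (1 + s) ≤ 1 := (div_le_one (by positivity)).2 hNs
    linarith
  have hθ1 : θ < 1 := by
    have : 0 < 1 / (D.card : ℝ) ^ (1 + s) := by positivity
    linarith
  have hθeq : (D.card : ℝ) ^ (1 + s) - 1 = θ * (D.card : ℝ) ^ (1 + s) := by
    rw [hθ]
    field_simp
  have key : ∀ k : ℕ, ∃ t, ((overlap n D c R t).card : ℝ) ≤ θ ^ k * (D.card : ℝ) ^ t := by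
    intro k
    induction k with
    | zero =>
      refine ⟨0, ?_⟩
      have : (overlap n D c R 0).card ≤ (digitNums n D 0).card := Finset.card_filter_le _ _
      simpa [digitNums] using this
    | succ k ih =>
      obtain ⟨t₀, ht₀⟩ := ih
      obtain ⟨t, ht, h⟩ := hloss t₀
      obtain ⟨u, rfl⟩ := Nat.exists_eq_add_of_le ht
      refine ⟨_, h.trans ?_⟩
      rw [hθeq]
      have h1 := hmono t₀ u
      calc ((overlap n D c R (t₀ + u)).card : ℝ) * (θ * (D.card : ℝ) ^ (1 + s))
          ≤ (θ ^ k * (D.card : ℝ) ^ t₀ * (D.card : ℝ) ^ u) * (θ * (D.card : ℝ) ^ (1 + s)) := by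
            gcongr
            exact h1.trans (by gcongr)
        _ = _ := by ring
  obtain ⟨k, hk⟩ := exists_pow_lt_of_lt_one hε hθ1
  obtain ⟨t₀, ht₀⟩ := key k
  refine ⟨t₀, fun t ht => ?_⟩
  obtain ⟨u, rfl⟩ := Nat.exists_eq_add_of_le ht
  calc ((overlap n D c R (t₀ + u)).card : ℝ) ≤ _ := hmono t₀ u
    _ ≤ (θ ^ k * (D.card : ℝ) ^ t₀) * (D.card : ℝ) ^ u := by gcongr
    _ ≤ (ε * (D.card : ℝ) ^ t₀) * (D.card : ℝ) ^ u := by gcongr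
    _ = _ := by ring

end Overlap

section Covering

variable {n m : ℕ} {Λ : Finset (ℕ × ℕ)}

lemma exists_finset_nat_interval (u : ℝ) {w : ℝ} (hw : 0 ≤ w) :
    ∃ S : Finset ℕ, (S.card : ℝ) ≤ w + 1 ∧ ∀ i : ℕ, u ≤ i → (i : ℝ) ≤ u + w → i ∈ S := by
  rcases lt_or_ge (u + w) 0 with h | h
  · exact ⟨∅, by simpa using by linarith, fun i _ h2 => absurd h2 (by
      have : (0 : ℝ) ≤ i := by positivity
      linarith)⟩
  refine ⟨Finset.Icc ⌈u⌉₊ ⌊u + w⌋₊, ?_, fun i h1 h2 =>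
    Finset.mem_Icc.2 ⟨Nat.ceil_le.2 h1, Nat.le_floor h2⟩⟩
  rw [Nat.card_Icc]
  have h1 := Nat.floor_le h
  have h2 := Nat.le_ceil u
  rcases le_total ⌈u⌉₊ (⌊u + w⌋₊ + 1) with h3 | h3
  · push_cast [h3]
    linarith
  · rw [Nat.sub_eq_zero_of_le h3]
    simp
    linarith

/-- In a window of width `2 C n ^ (-k)` and height `2 m ^ (-(k + t))`, the first coordinates of
the points of the carpet are covered by `O(N ^ t)` intervals of length `n ^ (-(k + t))`, where `N`
bounds the number of rectangles in each row. -/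
lemma BMCarpet.exists_cover (hn : 2 ≤ n) (hm : 2 ≤ m)
    (hΛ : Λ ⊆ Finset.range n ×ˢ Finset.range m) {N : ℕ}
    (hN : ∀ j, ((Λ.filter fun q => q.2 = j).image Prod.fst).card ≤ N) (k t : ℕ) (a b : ℝ)
    {C : ℝ} (hC : 0 ≤ C) :
    ∃ S : Finset ℕ, (S.card : ℝ) ≤ 4 * (2 * C + 2) * (N : ℝ) ^ t ∧ ∀ p ∈ BMCarpet n m Λ,
      |(n : ℝ) ^ k * p.1 - a| ≤ C → |(m : ℝ) ^ (k + t) * p.2 - b| ≤ 1 →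
      ∃ Z ∈ S, |(n : ℝ) ^ (k + t) * p.1 - Z| ≤ 1 := by
  obtain ⟨SI, hSI, hI⟩ := exists_finset_nat_interval (a - C - 1) (w := 2 * C + 1) (by linarith)
  obtain ⟨SJ, hSJ, hJ⟩ := exists_finset_nat_interval (b - 2) (w := 3) (by norm_num)
  refine ⟨(SJ ×ˢ SI).biUnion fun x => (rowNums n m Λ t (x.1 % m ^ t)).image
    fun r => n ^ t * x.2 + r, ?_, fun p hp hx hy => ?_⟩
  · have h1 := Finset.card_biUnion_le_card_mul (SJ ×ˢ SI)
      (fun x => (rowNums n m Λ t (x.1 % m ^ t)).image fun r => n ^ t * x.2 + r) (N ^ t)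
      fun x _ => Finset.card_image_le.trans (card_rowNums_le hN t _)
    rw [Finset.card_product] at h1
    have h2 : ((((SJ ×ˢ SI).biUnion fun x => (rowNums n m Λ t (x.1 % m ^ t)).image
      fun r => n ^ t * x.2 + r).card : ℕ) : ℝ) ≤ SJ.card * SI.card * (N : ℝ) ^ t := by
      exact_mod_cast h1
    refine h2.trans ?_
    gcongr <;> linarith
  · obtain ⟨I₁, J₁, -, -, q, hq, hx1, hy1⟩ := BMCarpet.exists_rowNums hn hm hΛ k hp
    obtain ⟨I₂, J₂, hI₂, hJ₂, r, hr, hx2, hy2⟩ := BMCarpet.exists_rowNums hn hm hΛ t hq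
    obtain ⟨⟨hq1, hq2⟩, -, -⟩ := BMCarpet.mem_unit hn hm hΛ hq
    obtain ⟨⟨hr1, hr2⟩, hr3, hr4⟩ := BMCarpet.mem_unit hn hm hΛ hr
    have hx' : (n : ℝ) ^ (k + t) * p.1 = ((n ^ t * I₁ + I₂ : ℕ) : ℝ) + r.1 := by
      rw [pow_add, mul_comm ((n : ℝ) ^ k), mul_assoc, hx1, mul_add, hx2]
      push_cast
      ring
    have hy' : (m : ℝ) ^ (k + t) * p.2 = ((m ^ t * J₁ + J₂ : ℕ) : ℝ) + r.2 := by
      rw [pow_add, mul_comm ((m : ℝ) ^ k), mul_assoc, hy1, mul_add, hy2]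
      push_cast
      ring
    rw [hy'] at hy
    rw [hx1] at hx
    rw [abs_le] at hx hy
    refine ⟨n ^ t * I₁ + I₂, Finset.mem_biUnion.2 ⟨(m ^ t * J₁ + J₂, I₁),
      Finset.mem_product.2 ⟨hJ _ (by linarith) (by linarith), hI _ (by linarith) (by linarith)⟩,
      Finset.mem_image.2 ⟨I₂, ?_, rfl⟩⟩, ?_⟩
    · rwa [Nat.mul_add_mod, Nat.mod_eq_of_lt hJ₂]
    · rw [hx', add_sub_cancel_left, abs_le]
      constructor <;> linarith

lemma not_countable_snd_image (hm : 2 ≤ m)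
    (hΛ : Λ ⊆ Finset.range n ×ˢ Finset.range m) {i₀ j₀ i₁ j₁ : ℕ}
    (h0 : (i₀, j₀) ∈ Λ) (h1 : (i₁, j₁) ∈ Λ) (hne : j₀ ≠ j₁) :
    ¬ (Prod.snd '' BMCarpet n m Λ).Countable := by
  intro hcount
  have hm' : (2 : ℝ) ≤ m := by exact_mod_cast hm
  let δ : (ℕ → Bool) → ℕ → ℕ × ℕ := fun g k =>
    if Odd k ∧ g (k / 2) = true then (i₁, j₁) else (i₀, j₀)
  have hδ : ∀ g k, δ g k ∈ Λ := fun g k => by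
    dsimp only [δ]
    split_ifs
    exacts [h1, h0]
  have hδm : ∀ g k, (δ g k).2 < m := fun g k =>
    Finset.mem_range.1 (Finset.mem_product.1 (hΛ (hδ g k))).2
  let F : (ℕ → Bool) → ℝ := fun g => ∑' k : ℕ, ((δ g k).2 : ℝ) / (m : ℝ) ^ (k + 1)
  set c : ℝ := ((m : ℝ) ^ 2)⁻¹ with hc
  have hc0 : 0 < c := by positivity
  have hc2 : c < 1 / 2 := by
    rw [hc, inv_lt_comm₀ (by positivity) (by norm_num)]
    nlinarith
  have hF : ∀ g, F g = (∑' k : ℕ, (j₀ : ℝ) / (m : ℝ) ^ (k + 1))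
      + ((j₁ : ℝ) - j₀) * c * Cardinal.cantorFunction c g := by
    intro g
    have hs := summable_digits hm (hδm g)
    have hs0 := summable_digits hm (d := fun _ => j₀) fun _ =>
      Finset.mem_range.1 (Finset.mem_product.1 (hΛ h0)).2
    have he : Function.Injective fun k : ℕ => 2 * k := fun a b h => by simpa using h
    have ho : Function.Injective fun k : ℕ => 2 * k + 1 := fun a b h => by simpa using h
    obtain ⟨G, hG⟩ : ∃ G : ℕ → ℝ, ∀ k, ((δ g k).2 : ℝ) / (m : ℝ) ^ (k + 1)
        - (j₀ : ℝ) / (m : ℝ) ^ (k + 1) = G k := ⟨_, fun k => rfl⟩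
    have hGs : Summable G := (hs.sub hs0).congr hG
    have hGe : Summable fun k => G (2 * k) := hGs.comp_injective he
    have hGo : Summable fun k => G (2 * k + 1) := hGs.comp_injective ho
    rw [← sub_eq_iff_eq_add', ← hs.tsum_sub hs0, tsum_congr hG, ← tsum_even_add_odd hGe hGo]
    have heven : ∀ k, δ g (2 * k) = (i₀, j₀) := fun k => if_neg fun h =>
      Nat.not_odd_iff_even.2 (even_two_mul k) h.1
    have hodd : ∀ k, δ g (2 * k + 1) = if g k = true then (i₁, j₁) else (i₀, j₀) := fun k => by
      have : (2 * k + 1) / 2 = k := by omega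
      simp [δ, this]
    simp only [← hG, heven, sub_self, tsum_zero, zero_add, hodd]
    rw [Cardinal.cantorFunction, ← tsum_mul_left]
    refine tsum_congr fun k => ?_
    cases hg : g k
    · simp [Cardinal.cantorFunctionAux_false hg]
    · rw [Cardinal.cantorFunctionAux_true hg, hc, inv_pow, ← pow_mul]
      simp only [if_true]
      rw [show 2 * k + 1 + 1 = 2 + 2 * k by ring, pow_add]
      field_simp
  have hinj : Function.Injective F := by
    intro g g' h
    rw [hF, hF] at h
    have hj : ((j₁ : ℝ) - j₀) * c ≠ 0 :=
      mul_ne_zero (sub_ne_zero.2 (by exact_mod_cast hne.symm)) hc0.ne'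
    exact Cardinal.cantorFunction_injective hc0 hc2 (mul_left_cancel₀ hj (add_left_cancel h))
  have hrange : (Set.range F).Countable := hcount.mono (by
    rintro _ ⟨g, rfl⟩
    exact ⟨(∑' k : ℕ, ((δ g k).1 : ℝ) / (n : ℝ) ^ (k + 1), F g),
      ⟨δ g, hδ g, rfl, rfl⟩, rfl⟩)
  rw [← Set.image_univ] at hrange
  have huniv := Set.countable_of_injective_of_countable_image hinj.injOn hrange
  have hle := Cardinal.mk_le_aleph0_iff.2 (Set.countable_univ_iff.1 huniv)
  refine absurd hle (not_le.2 ?_)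
  simp [Cardinal.aleph0_lt_continuum]

lemma exists_finset_irrational {B : Set ℝ} (hB : ¬ B.Countable) {κ : ℝ} (hκ : κ ≠ 0) (M : ℕ) :
    ∃ T : Finset ℝ, ↑T ⊆ B ∧ T.card = M ∧
      ∀ x ∈ T, ∀ y ∈ T, x ≠ y → Irrational (κ * (x - y)) := by
  classical
  induction M with
  | zero => exact ⟨∅, by simp⟩
  | succ M ih =>
    obtain ⟨T, hTB, hT, hirr⟩ := ih
    have hcount : (⋃ x ∈ T, Set.range fun q : ℚ => x + q / κ).Countable :=
      T.countable_toSet.biUnion fun x _ => Set.countable_range _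
    obtain ⟨b, hb, hbn⟩ : ∃ b ∈ B, b ∉ ⋃ x ∈ T, Set.range fun q : ℚ => x + q / κ := by
      by_contra! hcon
      exact hB (hcount.mono hcon)
    simp only [Set.mem_iUnion, Set.mem_range, not_exists] at hbn
    have hnew : ∀ x ∈ T, Irrational (κ * (b - x)) := by
      rintro x hx ⟨q, hq⟩
      refine hbn x hx q ?_
      rw [hq]
      field_simp
      ring
    have hbT : b ∉ T := fun h => (hnew b h) ⟨0, by simp⟩
    refine ⟨insert b T, ?_, by rw [Finset.card_insert_of_notMem hbT, hT], ?_⟩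
    · rw [Finset.coe_insert]
      exact Set.insert_subset hb hTB
    · intro x hx y hy hxy
      rcases Finset.mem_insert.1 hx with rfl | hx' <;> rcases Finset.mem_insert.1 hy with rfl | hy'
      · exact absurd rfl hxy
      · exact hnew y hy'
      · have := (hnew x hx').neg
        convert this using 1
        ring
      · exact hirr x hx' y hy' hxy

lemma BMCarpet.notMem_deleted (hn : 2 ≤ n) (hm : 2 ≤ m)
    (hΛ : Λ ⊆ Finset.range n ×ˢ Finset.range m) {i₁ j₁ : ℕ} (hi : i₁ < n) (hj : j₁ < m)
    (hij : (i₁, j₁) ∉ Λ) (k : ℕ) (X Y : ℤ) {p : ℝ × ℝ}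
    (hx1 : (n * X + i₁ : ℝ) < (n : ℝ) ^ (k + 1) * p.1)
    (hx2 : (n : ℝ) ^ (k + 1) * p.1 < n * X + i₁ + 1)
    (hy1 : (m * Y + j₁ : ℝ) < (m : ℝ) ^ (k + 1) * p.2)
    (hy2 : (m : ℝ) ^ (k + 1) * p.2 < m * Y + j₁ + 1) : p ∉ BMCarpet n m Λ := by
  intro hp
  obtain ⟨I, J, -, -, q, hq, h1, h2⟩ := BMCarpet.exists_rowNums hn hm hΛ k hp
  obtain ⟨i, j, hΛij, r, hr, h3, h4⟩ := BMCarpet.exists_eq_map hn hm hΛ hq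
  obtain ⟨⟨hr1, hr2⟩, hr3, hr4⟩ := BMCarpet.mem_unit hn hm hΛ hr
  have hi' : i < n := Finset.mem_range.1 (Finset.mem_product.1 (hΛ hΛij)).1
  have hj' : j < m := Finset.mem_range.1 (Finset.mem_product.1 (hΛ hΛij)).2
  have key : ∀ {b P x q r : ℝ} {I : ℝ} {i : ℝ}, b ≠ 0 → P * x = I + q → q = (r + i) / b →
      P * b * x = b * I + i + r := by
    intro b P x q r I i hb h h'
    rw [mul_right_comm, h, h']
    field_simp
    ring
  have hx := key (by positivity) h1 h3
  have hy := key (by positivity) h2 h4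
  have final : ∀ {b I : ℕ} {i i₁ : ℕ} {X : ℤ} {v r : ℝ}, i < b → i₁ < b → v = b * I + i + r →
      0 ≤ r → r ≤ 1 → (b * X + i₁ : ℝ) < v → v < b * X + i₁ + 1 → i = i₁ := by
    intro b I i i₁ X v r hi hi₁ hv hr0 hr1 hl hu
    have e1 : (b * I + i : ℤ) < b * X + i₁ + 1 := by
      have : (b * I + i : ℝ) < b * X + i₁ + 1 := by linarith
      exact_mod_cast this
    have e2 : (b * X + i₁ : ℤ) < b * I + i + 1 := by
      have : (b * X + i₁ : ℝ) < b * I + i + 1 := by linarith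
      exact_mod_cast this
    have e3 : (b * I + i : ℤ) = b * X + i₁ := by omega
    have e4 := congrArg (· % (b : ℤ)) e3
    simp only [Int.mul_add_emod_self_left] at e4
    rw [Int.emod_eq_of_lt (by omega) (by omega), Int.emod_eq_of_lt (by omega) (by omega)] at e4
    exact_mod_cast e4
  rw [pow_succ] at hx1 hx2 hy1 hy2
  exact hij (by
    rw [← final hi' hi hx hr1 hr2 hx1 hx2, ← final hj' hj hy hr3 hr4 hy1 hy2]
    exact hΛij)

lemma exists_int_mul_add_mem (v c : ℝ) {b : ℝ} (hb : 0 < b) :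
    ∃ X : ℤ, v ≤ b * X + c ∧ b * X + c < v + b := by
  have h1 := Int.le_ceil ((v - c) / b)
  have h2 := Int.ceil_lt_add_one ((v - c) / b)
  refine ⟨⌈(v - c) / b⌉, ?_, ?_⟩
  · rw [div_le_iff₀ hb] at h1
    linarith
  · rw [← sub_lt_iff_lt_add, lt_div_iff₀ hb] at h2
    linarith

/-- A carpet with at least one deleted rectangle contains no oblique segment. -/
lemma BMCarpet.no_oblique_segment (hm : 2 ≤ m) (hnm : m < n)
    (hΛ : Λ ⊆ Finset.range n ×ˢ Finset.range m) (hΛ2 : Λ.card < m * n) {p q α γ : ℝ}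
    (hα : α ≠ 0) (hγ : γ ≠ 0)
    (hseg : ∀ s : ℝ, 0 ≤ s → s < 1 → (p + α * s, q + γ * s) ∈ BMCarpet n m Λ) : False := by
  obtain ⟨⟨i₁, j₁⟩, hmem, hij⟩ : ∃ x ∈ Finset.range n ×ˢ Finset.range m, x ∉ Λ := by
    by_contra! hcon
    have := Finset.card_le_card hcon
    rw [Finset.card_product, Finset.card_range, Finset.card_range, mul_comm] at this
    omega
  obtain ⟨hi, hj⟩ := Finset.mem_product.1 hmem
  have hi := Finset.mem_range.1 hi
  have hj := Finset.mem_range.1 hj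
  have hm' : (2 : ℝ) ≤ m := by exact_mod_cast hm
  have hnm' : (m : ℝ) < n := by exact_mod_cast hnm
  have hα' : 0 < |α| := abs_pos.2 hα
  have hγ' : 0 < |γ| := abs_pos.2 hγ
  obtain ⟨k₁, hk₁⟩ := pow_unbounded_of_one_lt (4 / |γ|) (show (1 : ℝ) < m by linarith)
  obtain ⟨k₂, hk₂⟩ := pow_unbounded_of_one_lt (4 / |α|) (show (1 : ℝ) < n by linarith)
  obtain ⟨k₃, hk₃⟩ := pow_unbounded_of_one_lt (2 * |γ| * m / |α|)
    (show (1 : ℝ) < n / m by rw [one_lt_div (by linarith)]; exact hnm')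
  set k := k₁ + k₂ + k₃
  replace hk₁ : 4 / |γ| < (m : ℝ) ^ k :=
    hk₁.trans_le (pow_le_pow_right₀ (by linarith) (by omega))
  replace hk₂ : 4 / |α| < (n : ℝ) ^ k :=
    hk₂.trans_le (pow_le_pow_right₀ (by linarith) (by omega))
  replace hk₃ : 2 * |γ| * m / |α| < ((n : ℝ) / m) ^ k :=
    hk₃.trans_le (pow_le_pow_right₀ (by
      rw [one_le_div (by linarith)]
      exact hnm'.le) (by omega))
  rw [div_lt_iff₀ (by positivity)] at hk₁ hk₂ hk₃
  have hM : (0 : ℝ) < (m : ℝ) ^ k := by positivity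
  have hNk : (0 : ℝ) < (n : ℝ) ^ k := by
    have : (0 : ℝ) < n := by linarith
    positivity
  rw [div_pow, div_mul_eq_mul_div, lt_div_iff₀ hM] at hk₃
  have hn0 : (0 : ℝ) < n := by linarith
  obtain ⟨Y, hY1, hY2⟩ := exists_int_mul_add_mem ((m : ℝ) ^ (k + 1) * (q + γ / 2)) (j₁ + 1 / 2)
    (show (0 : ℝ) < m by linarith)
  set s₁ : ℝ := ((m * Y + (j₁ + 1 / 2)) / (m : ℝ) ^ (k + 1) - q) / γ with hs₁
  have hs₁eq : (m : ℝ) ^ (k + 1) * (q + γ * s₁) = m * Y + (j₁ + 1 / 2) := by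
    rw [hs₁]
    field_simp
    ring
  obtain ⟨X, hX1, hX2⟩ := exists_int_mul_add_mem ((n : ℝ) ^ (k + 1) * (p + α * s₁)) (i₁ + 1 / 2)
    hn0
  set s : ℝ := ((n * X + (i₁ + 1 / 2)) / (n : ℝ) ^ (k + 1) - p) / α with hs
  have hseq : (n : ℝ) ^ (k + 1) * (p + α * s) = n * X + (i₁ + 1 / 2) := by
    rw [hs]
    field_simp
    ring
  have hd1 : |s₁ - 1 / 2| < 1 / 4 := by
    have h1 : |(m : ℝ) ^ (k + 1) * γ * (s₁ - 1 / 2)| ≤ m := by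
      rw [abs_le]
      constructor <;> linarith
    rw [abs_mul, abs_mul, abs_of_pos (by positivity : (0 : ℝ) < (m : ℝ) ^ (k + 1)), pow_succ] at h1
    have h2 : (m : ℝ) ^ k * |γ| * |s₁ - 1 / 2| ≤ 1 := by
      refine le_of_mul_le_mul_left (a := (m : ℝ)) ?_ (by linarith)
      linarith
    by_contra! hcon
    nlinarith
  have hd2 : (n : ℝ) ^ k * |α| * |s - s₁| ≤ 1 := by
    have h1 : |(n : ℝ) ^ (k + 1) * α * (s - s₁)| ≤ n := by
      rw [abs_le]
      constructor <;> linarith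
    rw [abs_mul, abs_mul, abs_of_pos (by positivity : (0 : ℝ) < (n : ℝ) ^ (k + 1)), pow_succ] at h1
    refine le_of_mul_le_mul_left (a := (n : ℝ)) ?_ hn0
    linarith
  have hd3 : |s - s₁| < 1 / 4 := by
    by_contra! hcon
    nlinarith
  have hd4 : |(m : ℝ) ^ (k + 1) * γ * (s - s₁)| < 1 / 2 := by
    rw [abs_mul, abs_mul, abs_of_pos (by positivity : (0 : ℝ) < (m : ℝ) ^ (k + 1)), pow_succ]
    rcases (abs_nonneg (s - s₁)).eq_or_lt with h0 | h0
    · rw [← h0]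
      norm_num
    · have := mul_lt_mul_of_pos_right hk₃ h0
      linarith
  rw [abs_lt] at hd1 hd3 hd4
  refine BMCarpet.notMem_deleted (p := (p + α * s, q + γ * s)) (by omega) hm hΛ hi hj hij k X Y
    ?_ ?_ ?_ ?_ (hseg s (by linarith) (by linarith)) <;> dsimp only <;> linarith

end Covering

section Main

open Filter Topology

variable {n m : ℕ} {Λ : Finset (ℕ × ℕ)}

lemma BMCarpet.exists_points (hn : 2 ≤ n) (hm : 2 ≤ m)
    (hΛ : Λ ⊆ Finset.range n ×ˢ Finset.range m) {D : Finset ℕ} {j : ℕ}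
    (hD : ∀ i ∈ D, (i, j) ∈ Λ) (hDne : D.Nonempty) (k t u : ℕ) :
    ∃ X Y : ℝ, ∀ d ∈ digitNums n D t, ∀ p ∈ BMCarpet n m Λ, ∃ x ξ : ℝ,
      (x, (p.2 + Y) / (m : ℝ) ^ (k + t + u)) ∈ BMCarpet n m Λ ∧ 0 ≤ ξ ∧ ξ ≤ 1 ∧
      (n : ℝ) ^ (k + t) * x = (n : ℝ) ^ t * X + d + ξ := by
  have hDn : D ⊆ Finset.range n := fun i hi => (Finset.mem_product.1 (hΛ (hD i hi))).1
  have hne : ∀ s, (digitNums n D s).Nonempty := fun s => by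
    rw [← Finset.card_pos, card_digitNums hDn]
    have := hDne.card_pos
    positivity
  obtain ⟨a, ha⟩ := hne k
  obtain ⟨e, he⟩ := hne u
  obtain ⟨Y, hY⟩ := BMCarpet.digitNums_mem hn hm hΛ hD (k + t + u)
  refine ⟨a, Y, fun d hd p hp => ?_⟩
  have hmem : n ^ u * (n ^ t * a + d) + e ∈ digitNums n D (k + t + u) := by
    rw [digitNums_add]
    refine Finset.mem_image₂_of_mem ?_ he
    rw [digitNums_add]
    exact Finset.mem_image₂_of_mem ha hd
  obtain ⟨⟨hp0, hp1⟩, -⟩ := BMCarpet.mem_unit hn hm hΛ hp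
  have hu : (0 : ℝ) < (n : ℝ) ^ u := by positivity
  have he1 : (e : ℝ) + 1 ≤ (n : ℝ) ^ u := by exact_mod_cast digitNums_lt hDn he
  refine ⟨_, (e + p.1) / (n : ℝ) ^ u, hY _ hmem p hp, by positivity, ?_, ?_⟩
  · rw [div_le_one hu]
    linarith
  · push_cast
    rw [pow_add _ (k + t) u]
    field_simp
    ring

/-- Pigeonhole step: a map defined on pairs `(x, d)` cannot have few values if pairs with the same
value have nearby second entries, or second entries in small overlaps. -/
lemma card_mul_le_of_overlap {D : Finset ℕ} (hD : D ⊆ Finset.range n) {R κ : ℝ} (hR : 0 ≤ R)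
    {t : ℕ} {T : Finset ℝ} (hT : T.Nonempty) {S : Finset ℕ} {F : ℝ → ℕ → ℕ}
    (hFS : ∀ x ∈ T, ∀ d ∈ digitNums n D t, F x d ∈ S)
    (hF : ∀ x ∈ T, ∀ y ∈ T, ∀ d ∈ digitNums n D t, ∀ e ∈ digitNums n D t, F x d = F y e →
      |(d : ℝ) - e - (n : ℝ) ^ t * (κ * (y - x))| ≤ R)
    (hov : ∀ x ∈ T, ∀ y ∈ T, y ≠ x → ((overlap n D (κ * (y - x)) R t).card : ℝ)
      ≤ 1 / (2 * T.card) * (D.card : ℝ) ^ t) :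
    (T.card : ℝ) * (D.card : ℝ) ^ t ≤ 2 * (2 * R + 1) * S.card := by
  classical
  have hTpos : (0 : ℝ) < T.card := by exact_mod_cast hT.card_pos
  set E : ℝ → Finset ℕ := fun x =>
    digitNums n D t \ (T.erase x).biUnion fun y => overlap n D (κ * (y - x)) R t with hE
  have hEcard : ∀ x ∈ T, 1 / 2 * (D.card : ℝ) ^ t ≤ (E x).card := by
    intro x hx
    have h1 := Finset.card_le_card_sdiff_add_card
      (s := digitNums n D t) (t := (T.erase x).biUnion fun y => overlap n D (κ * (y - x)) R t)
    rw [card_digitNums hD] at h1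
    have h2 : (D.card : ℝ) ^ t ≤ (E x).card
        + ((T.erase x).biUnion fun y => overlap n D (κ * (y - x)) R t).card := by
      exact_mod_cast h1
    have h3 : (((T.erase x).biUnion fun y => overlap n D (κ * (y - x)) R t).card : ℝ)
        ≤ ∑ y ∈ T.erase x, ((overlap n D (κ * (y - x)) R t).card : ℝ) := by
      exact_mod_cast Finset.card_biUnion_le
    have h4 : ∑ y ∈ T.erase x, ((overlap n D (κ * (y - x)) R t).card : ℝ)
        ≤ (T.erase x).card • (1 / (2 * T.card) * (D.card : ℝ) ^ t) :=
      Finset.sum_le_card_nsmul _ _ _ fun y hy =>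
        hov x hx y (Finset.mem_of_mem_erase hy) (Finset.ne_of_mem_erase hy)
    have h5 : (((T.erase x).card : ℕ) : ℝ) ≤ T.card := by
      exact_mod_cast Finset.card_le_card (Finset.erase_subset x T)
    rw [nsmul_eq_mul] at h4
    have h6 : ((T.erase x).card : ℝ) * (1 / (2 * T.card) * (D.card : ℝ) ^ t)
        ≤ T.card * (1 / (2 * T.card) * (D.card : ℝ) ^ t) := by gcongr
    have h7 : (T.card : ℝ) * (1 / (2 * T.card) * (D.card : ℝ) ^ t) = 1 / 2 * (D.card : ℝ) ^ t := by
      field_simp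
    linarith
  set G : Finset (Σ _ : ℝ, ℕ) := T.sigma E with hG
  have hlow : (T.card : ℝ) * (1 / 2 * (D.card : ℝ) ^ t) ≤ G.card := by
    rw [hG, Finset.card_sigma]
    push_cast
    rw [← nsmul_eq_mul]
    exact Finset.card_nsmul_le_sum _ _ _ hEcard
  have hmem : ∀ a ∈ G, a.1 ∈ T ∧ a.2 ∈ digitNums n D t ∧
      ∀ y ∈ T, y ≠ a.1 → a.2 ∉ overlap n D (κ * (y - a.1)) R t := by
    intro a ha
    obtain ⟨h1, h2⟩ := Finset.mem_sigma.1 ha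
    obtain ⟨h3, h4⟩ := Finset.mem_sdiff.1 h2
    exact ⟨h1, h3, fun y hy hne hcon =>
      h4 (Finset.mem_biUnion.2 ⟨y, Finset.mem_erase.2 ⟨hne, hy⟩, hcon⟩)⟩
  have hup : G.card ≤ ⌊2 * R + 1⌋₊ * S.card := by
    refine Finset.card_le_mul_card_image_of_maps_to (f := fun a : Σ _ : ℝ, ℕ => F a.1 a.2)
      (fun a ha => hFS _ (hmem a ha).1 _ (hmem a ha).2.1) _ fun z _ => ?_
    rcases (G.filter fun a => F a.1 a.2 = z).eq_empty_or_nonempty with h0 | ⟨a₀, ha₀⟩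
    · simp [h0]
    obtain ⟨ha₀G, rfl⟩ := Finset.mem_filter.1 ha₀
    obtain ⟨hx₀, hd₀, hgood⟩ := hmem a₀ ha₀G
    obtain ⟨SR, hSR, hSRmem⟩ := exists_finset_nat_interval ((a₀.2 : ℝ) - R) (w := 2 * R)
      (by linarith)
    refine (Finset.card_le_card (t := SR.image fun d => ⟨a₀.1, d⟩) fun a ha => ?_).trans
      (Finset.card_image_le.trans (Nat.le_floor hSR))
    obtain ⟨haG, haF⟩ := Finset.mem_filter.1 ha
    obtain ⟨hx, hd, -⟩ := hmem a haG
    have hclose := hF _ hx₀ _ hx _ hd₀ _ hd haF.symm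
    have hxx : a.1 = a₀.1 := by
      by_contra hne
      exact hgood _ hx hne (mem_overlap.2 ⟨hd₀, _, hd, hclose⟩)
    rw [hxx, sub_self, mul_zero, mul_zero, sub_zero, abs_le] at hclose
    refine Finset.mem_image.2 ⟨a.2, hSRmem _ (by linarith) (by linarith), ?_⟩
    exact Sigma.ext hxx.symm HEq.rfl
  have hup' : (G.card : ℝ) ≤ (2 * R + 1) * S.card := by
    calc (G.card : ℝ) ≤ ((⌊2 * R + 1⌋₊ * S.card : ℕ) : ℝ) := by exact_mod_cast hup
      _ = (⌊2 * R + 1⌋₊ : ℝ) * S.card := by push_cast; ring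
      _ ≤ _ := by
        gcongr
        exact Nat.floor_le (by linarith)
  linarith

/-- Some bounded ratios `n ^ k / m ^ l` accumulate at a positive number. -/
lemma exists_ratio_limit (hn : 2 ≤ n) (hm : 2 ≤ m) :
    ∃ ρ : ℝ, 0 < ρ ∧ ∃ φ l : ℕ → ℕ, StrictMono φ ∧ (∀ i, (n : ℝ) ^ φ i ≤ (m : ℝ) ^ l i) ∧
      Tendsto (fun i => (n : ℝ) ^ φ i / (m : ℝ) ^ l i) atTop (𝓝 ρ) := by
  have hn' : (2 : ℝ) ≤ n := by exact_mod_cast hn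
  have hm' : (2 : ℝ) ≤ m := by exact_mod_cast hm
  have hex : ∀ k : ℕ, ∃ l : ℕ, (n : ℝ) ^ k ≤ (m : ℝ) ^ l ∧ (m : ℝ) ^ l ≤ (n : ℝ) ^ k * m := by
    intro k
    obtain ⟨l, h1, h2⟩ := exists_nat_pow_near (x := (n : ℝ) ^ k) (y := (m : ℝ))
      (one_le_pow₀ (by linarith)) (by linarith)
    exact ⟨l + 1, h2.le, by rw [pow_succ]; gcongr⟩
  choose l hl1 hl2 using hex
  have hmem : ∀ k, (n : ℝ) ^ k / (m : ℝ) ^ l k ∈ Set.Icc (1 / (m : ℝ)) 1 := by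
    intro k
    have hM : (0 : ℝ) < (m : ℝ) ^ l k := by positivity
    refine ⟨?_, (div_le_one hM).2 (hl1 k)⟩
    rw [div_le_div_iff₀ (by linarith) hM, one_mul]
    exact hl2 k
  obtain ⟨ρ, hρ, φ, hφ, hlim⟩ := isCompact_Icc.tendsto_subseq hmem
  exact ⟨ρ, lt_of_lt_of_le (by positivity) hρ.1, φ, l ∘ φ, hφ, fun i => hl1 _, hlim⟩

lemma BMCarpet.no_oblique_affine (hm : 2 ≤ m) (hnm : m < n)
    (hΛ : Λ ⊆ Finset.range n ×ˢ Finset.range m) {D : Finset ℕ} {j : ℕ}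
    (hD : ∀ i ∈ D, (i, j) ∈ Λ) (hDne : D.Nonempty) (hDn : D.card < n)
    (hN : ∀ j, ((Λ.filter fun q => q.2 = j).image Prod.fst).card ≤ D.card)
    {i₀ j₀ i₁ j₁ : ℕ} (h0 : (i₀, j₀) ∈ Λ) (h1 : (i₁, j₁) ∈ Λ) (hne : j₀ ≠ j₁)
    {p q α β γ δ : ℝ} (hα : α ≠ 0) (hβ : β ≠ 0)
    (hmap : ∀ x ∈ BMCarpet n m Λ, (p + α * x.1 + β * x.2, q + γ * x.1 + δ * x.2) ∈ BMCarpet n m Λ) :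
    False := by
  have hn : 2 ≤ n := by omega
  have hm' : (2 : ℝ) ≤ m := by exact_mod_cast hm
  have hnm' : (m : ℝ) < n := by exact_mod_cast hnm
  have hDsub : D ⊆ Finset.range n := fun i hi => (Finset.mem_product.1 (hΛ (hD i hi))).1
  obtain ⟨ρ, hρ, φ, l, hφ, hl, hlim⟩ := exists_ratio_limit hn hm
  have hα' : 0 < |α| := abs_pos.2 hα
  set κ := β / α * ρ with hκ
  have hκ0 : κ ≠ 0 := mul_ne_zero (div_ne_zero hβ hα) hρ.ne'
  set R := 2 / |α| + 2 with hR
  have hR1 : 1 ≤ R := by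
    have : 0 < 2 / |α| := by positivity
    linarith
  set C := |α| + |β| with hC
  have hC0 : 0 ≤ C := by positivity
  obtain ⟨M, hM⟩ := exists_nat_gt (2 * (2 * R + 1) * (4 * (2 * C + 2)))
  obtain ⟨T, hTK, hTM, hirr⟩ :=
    exists_finset_irrational (not_countable_snd_image hm hΛ h0 h1 hne) hκ0 M
  have hMpos : (0 : ℝ) < M := lt_of_le_of_lt (by positivity) hM
  have hTne : T.Nonempty := by
    rw [← Finset.card_pos, hTM]
    exact_mod_cast hMpos
  obtain ⟨t, ht⟩ : ∃ t, ∀ x ∈ T, ∀ y ∈ T, y ≠ x → ((overlap n D (κ * (y - x)) R t).card : ℝ)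
      ≤ 1 / (2 * T.card) * (D.card : ℝ) ^ t := by
    have : ∀ᶠ t in atTop, ∀ x ∈ T, ∀ y ∈ T, y ≠ x →
        ((overlap n D (κ * (y - x)) R t).card : ℝ) ≤ 1 / (2 * T.card) * (D.card : ℝ) ^ t := by
      refine (eventually_all_finset T).2 fun x hx => (eventually_all_finset T).2 fun y hy => ?_
      by_cases hxy : y = x
      · exact Eventually.of_forall fun t h => absurd hxy h
      · obtain ⟨t₀, ht₀⟩ := exists_card_overlap_le hn hDsub hDne hDn hR1 (hirr y hy x hx hxy)
          (ε := 1 / (2 * T.card)) (by rw [hTM]; positivity)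
        filter_upwards [eventually_ge_atTop t₀] with t htt _ using ht₀ t htt
    exact this.exists
  set W := |γ| + |δ| + 1 with hW
  have hW1 : 1 ≤ W := by
    have := abs_nonneg γ
    have := abs_nonneg δ
    linarith
  obtain ⟨i, hi1, hi2⟩ : ∃ i, |β / α| * (n : ℝ) ^ t * |(n : ℝ) ^ φ i / (m : ℝ) ^ l i - ρ| < 1 ∧
      (m : ℝ) ^ t * W < ((n : ℝ) / m) ^ φ i := by
    have e1 : Tendsto (fun i => |β / α| * (n : ℝ) ^ t * |(n : ℝ) ^ φ i / (m : ℝ) ^ l i - ρ|)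
        atTop (𝓝 (|β / α| * (n : ℝ) ^ t * |ρ - ρ|)) :=
      ((hlim.sub_const ρ).abs).const_mul _
    rw [sub_self, abs_zero, mul_zero] at e1
    have e2 : Tendsto (fun i => ((n : ℝ) / m) ^ φ i) atTop atTop :=
      (tendsto_pow_atTop_atTop_of_one_lt
        (by rw [one_lt_div (by linarith)]; exact hnm')).comp hφ.tendsto_atTop
    exact ((e1.eventually_lt_const one_pos).and (e2.eventually_gt_atTop _)).exists
  have hlk := hl i
  set k := φ i
  set L := l i
  have hn0 : (0 : ℝ) < n := by linarith
  have hm0 : (0 : ℝ) < m := by linarith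
  rw [div_pow, lt_div_iff₀ (by positivity)] at hi2
  have hkt : (m : ℝ) ^ (k + t) * W ≤ (n : ℝ) ^ k := by
    rw [pow_add]
    linarith
  have hLkt : k + t ≤ L := by
    have : (m : ℝ) ^ (k + t) ≤ (m : ℝ) ^ L := by
      have : (m : ℝ) ^ (k + t) * 1 ≤ (m : ℝ) ^ (k + t) * W := by gcongr
      linarith
    exact (pow_le_pow_iff_right₀ (by linarith)).1 this
  obtain ⟨u, hu⟩ := Nat.exists_eq_add_of_le hLkt
  obtain ⟨X, Y, hXY⟩ := BMCarpet.exists_points hn hm hΛ hD hDne k t u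
  rw [← hu] at hXY
  set r := (n : ℝ) ^ k / (m : ℝ) ^ L with hr
  have hr0 : 0 ≤ r := by positivity
  have hr1 : r ≤ 1 := (div_le_one (by positivity)).2 hlk
  obtain ⟨S, hS, hcov⟩ := BMCarpet.exists_cover hn hm hΛ hN k t
    ((n : ℝ) ^ k * p + α * X + β * (r * Y))
    ((m : ℝ) ^ (k + t) * (q + γ * (X / (n : ℝ) ^ k) + δ * (Y / (m : ℝ) ^ L))) hC0
  have hZ : ∀ x : ℝ, ∀ d : ℕ, ∃ Z : ℕ, x ∈ T → d ∈ digitNums n D t → Z ∈ S ∧ ∃ ξ : ℝ, 0 ≤ ξ ∧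
      ξ ≤ 1 ∧ |(n : ℝ) ^ (k + t) * p + α * ((n : ℝ) ^ t * X + d + ξ)
        + β * ((n : ℝ) ^ t * (r * (x + Y))) - Z| ≤ 1 := by
    intro x d
    by_cases hxd : x ∈ T ∧ d ∈ digitNums n D t
    swap
    · exact ⟨0, fun h h' => absurd ⟨h, h'⟩ hxd⟩
    obtain ⟨hx, hd⟩ := hxd
    obtain ⟨P, hP, rfl⟩ := hTK hx
    obtain ⟨x', ξ, hmem, hξ0, hξ1, heq⟩ := hXY d hd P hP
    obtain ⟨-, hP0, hP1⟩ := BMCarpet.mem_unit hn hm hΛ hP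
    have hnt : (0 : ℝ) < (n : ℝ) ^ t := by positivity
    have hnk : (0 : ℝ) < (n : ℝ) ^ k := by positivity
    have hmL : (0 : ℝ) < (m : ℝ) ^ L := by positivity
    have hmkt : (0 : ℝ) < (m : ℝ) ^ (k + t) := by positivity
    obtain ⟨η, hη0, hη1, hη⟩ : ∃ η : ℝ, 0 ≤ η ∧ η ≤ 1 ∧ (n : ℝ) ^ k * x' = X + η := by
      refine ⟨(d + ξ) / (n : ℝ) ^ t, by positivity, ?_, ?_⟩
      · rw [div_le_one hnt]
        have : (d : ℝ) + 1 ≤ (n : ℝ) ^ t := by exact_mod_cast digitNums_lt hDsub hd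
        linarith
      · rw [pow_add] at heq
        field_simp
        linarith
    have hx' : x' = (X + η) / (n : ℝ) ^ k := by
      rw [← hη]
      field_simp
    have hcol : |(n : ℝ) ^ k * (p + α * x' + β * ((P.2 + Y) / (m : ℝ) ^ L))
        - ((n : ℝ) ^ k * p + α * X + β * (r * Y))| ≤ C := by
      have : (n : ℝ) ^ k * (p + α * x' + β * ((P.2 + Y) / (m : ℝ) ^ L))
          - ((n : ℝ) ^ k * p + α * X + β * (r * Y)) = α * η + β * (r * P.2) := by
        rw [hx', hr]
        field_simp
        ring
      rw [this]
      refine (abs_add_le _ _).trans ?_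
      rw [abs_mul, abs_mul, abs_of_nonneg hη0, abs_of_nonneg (mul_nonneg hr0 hP0), hC]
      gcongr
      · exact mul_le_of_le_one_right (abs_nonneg _) hη1
      · exact mul_le_of_le_one_right (abs_nonneg _) (mul_le_one₀ hr1 hP0 hP1)
    have hrow : |(m : ℝ) ^ (k + t) * (q + γ * x' + δ * ((P.2 + Y) / (m : ℝ) ^ L))
        - (m : ℝ) ^ (k + t) * (q + γ * (X / (n : ℝ) ^ k) + δ * (Y / (m : ℝ) ^ L))| ≤ 1 := by
      have : (m : ℝ) ^ (k + t) * (q + γ * x' + δ * ((P.2 + Y) / (m : ℝ) ^ L))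
          - (m : ℝ) ^ (k + t) * (q + γ * (X / (n : ℝ) ^ k) + δ * (Y / (m : ℝ) ^ L))
          = (m : ℝ) ^ (k + t) / (n : ℝ) ^ k * (γ * η + δ * (r * P.2)) := by
        rw [hx', hr]
        field_simp
        ring
      rw [this, abs_mul, abs_of_pos (by positivity), div_mul_eq_mul_div, div_le_one hnk]
      refine le_trans ?_ hkt
      gcongr
      refine (abs_add_le _ _).trans ?_
      rw [abs_mul, abs_mul, abs_of_nonneg hη0, abs_of_nonneg (mul_nonneg hr0 hP0), hW]
      have e1 : |γ| * η ≤ |γ| := mul_le_of_le_one_right (abs_nonneg _) hη1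
      have e2 : |δ| * (r * P.2) ≤ |δ| :=
        mul_le_of_le_one_right (abs_nonneg _) (mul_le_one₀ hr1 hP0 hP1)
      linarith
    obtain ⟨Z, hZS, hZ⟩ := hcov _ (hmap _ hmem) hcol hrow
    refine ⟨Z, fun _ _ => ⟨hZS, ξ, hξ0, hξ1, ?_⟩⟩
    refine le_trans (le_of_eq ?_) hZ
    congr 1
    rw [← heq, hr, pow_add]
    field_simp
  choose F hF using hZ
  have hmain := card_mul_le_of_overlap (κ := κ) hDsub (by linarith) hTne
    (fun x hx d hd => (hF x d hx hd).1) (fun x hx y hy d hd e he hxy => ?_) ht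
  · rw [hTM] at hmain
    have hpow : (0 : ℝ) < (D.card : ℝ) ^ t := by
      have : (0 : ℝ) < D.card := by exact_mod_cast hDne.card_pos
      positivity
    have e1 : 2 * (2 * R + 1) * (S.card : ℝ)
        ≤ 2 * (2 * R + 1) * (4 * (2 * C + 2) * (D.card : ℝ) ^ t) := by gcongr
    have e2 := mul_lt_mul_of_pos_right hM hpow
    linarith
  · obtain ⟨-, ξ, hξ0, hξ1, hb⟩ := hF x d hx hd
    obtain ⟨-, ζ, hζ0, hζ1, hb'⟩ := hF y e hy he
    rw [← hxy] at hb'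
    have hunit : ∀ z ∈ T, 0 ≤ z ∧ z ≤ 1 := by
      intro z hz
      obtain ⟨P, hP, rfl⟩ := hTK hz
      exact (BMCarpet.mem_unit hn hm hΛ hP).2
    have hxy1 : |x - y| ≤ 1 := by
      have := hunit x hx
      have := hunit y hy
      rw [abs_le]
      constructor <;> linarith
    have e1 : |α * (((d : ℝ) - e) + (ξ - ζ) + β / α * ((n : ℝ) ^ t * (r * (x - y))))| ≤ 2 := by
      have : α * (((d : ℝ) - e) + (ξ - ζ) + β / α * ((n : ℝ) ^ t * (r * (x - y))))
          = α * ((d : ℝ) - e) + α * (ξ - ζ) + β * ((n : ℝ) ^ t * (r * (x - y))) := by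
        field_simp
      rw [this]
      rw [abs_le] at hb hb' ⊢
      constructor <;> linarith
    rw [abs_mul, ← le_div_iff₀' hα'] at e1
    have e2 : |β / α * ((n : ℝ) ^ t * ((r - ρ) * (x - y)))| ≤ 1 := by
      rw [abs_mul, abs_mul, abs_mul, abs_of_pos (by positivity : (0 : ℝ) < (n : ℝ) ^ t)]
      calc |β / α| * ((n : ℝ) ^ t * (|r - ρ| * |x - y|))
          = |β / α| * (n : ℝ) ^ t * |r - ρ| * |x - y| := by ring
        _ ≤ 1 := mul_le_one₀ hi1.le (abs_nonneg _) hxy1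
    have e3 : (d : ℝ) - e - (n : ℝ) ^ t * (κ * (y - x))
        = (((d : ℝ) - e) + (ξ - ζ) + β / α * ((n : ℝ) ^ t * (r * (x - y)))) - (ξ - ζ)
          - β / α * ((n : ℝ) ^ t * ((r - ρ) * (x - y))) := by
      rw [hκ]
      ring
    rw [e3, hR]
    rw [abs_le] at e1 e2 ⊢
    constructor <;> linarith

lemma BMCarpet.exists_horizontal_segment (hn : 2 ≤ n) {j : ℕ}
    (hrow : ∀ i < n, (i, j) ∈ Λ) : ∃ y : ℝ, ∀ x : ℝ, 0 ≤ x → x < 1 → (x, y) ∈ BMCarpet n m Λ := by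
  have : NeZero n := ⟨by omega⟩
  refine ⟨∑' k : ℕ, (j : ℝ) / (m : ℝ) ^ (k + 1), fun x hx0 hx1 =>
    ⟨fun k => (Real.digits x n k, j), fun k => hrow _ (Real.digits x n k).2, ?_, rfl⟩⟩
  exact (Real.ofDigits_digits (by omega) ⟨hx0, hx1⟩).symm

lemma IsSimilitude.eq_affine {f : ℝ × ℝ → ℝ × ℝ} {l : ℝ} (hf : IsSimilitude f l) (ho : Oblique f) :
    ∃ p q α β γ δ : ℝ, α ≠ 0 ∧ β ≠ 0 ∧ γ ≠ 0 ∧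
      ∀ x, f x = (p + α * x.1 + β * x.2, q + γ * x.1 + δ * x.2) := by
  have hsq : ∀ x y : ℝ × ℝ, ((f x).1 - (f y).1) ^ 2 + ((f x).2 - (f y).2) ^ 2
      = l ^ 2 * ((x.1 - y.1) ^ 2 + (x.2 - y.2) ^ 2) := by
    intro x y
    have h := congrArg (· ^ 2) (hf x y)
    simp only [mul_pow] at h
    rwa [Real.sq_sqrt (by positivity), Real.sq_sqrt (by positivity)] at h
  obtain ⟨hα, hγ⟩ := ho
  have huv := hsq (1, 0) (0, 1)
  have hu := hsq (1, 0) (0, 0)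
  have hv := hsq (0, 1) (0, 0)
  refine ⟨(f (0, 0)).1, (f (0, 0)).2, (f (1, 0)).1 - (f (0, 0)).1, (f (0, 1)).1 - (f (0, 0)).1,
    (f (1, 0)).2 - (f (0, 0)).2, (f (0, 1)).2 - (f (0, 0)).2, hα, ?_, hγ, fun x => ?_⟩
  · intro hβ
    norm_num at huv hu hv
    have horth : ((f (1, 0)).2 - (f (0, 0)).2) * ((f (0, 1)).2 - (f (0, 0)).2) = 0 := by
      linear_combination (-1 / 2) * huv + (1 / 2) * hu + (1 / 2) * hv
        - ((f (1, 0)).1 - (f (0, 0)).1) * hβ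
    have hδ := (mul_eq_zero.1 horth).resolve_left hγ
    rw [hβ, hδ] at hv
    have : 0 < ((f (1, 0)).1 - (f (0, 0)).1) ^ 2 := by positivity
    nlinarith [sq_nonneg ((f (1, 0)).2 - (f (0, 0)).2)]
  · have h0 := hsq x (0, 0)
    have h1 := hsq x (1, 0)
    have h2 := hsq x (0, 1)
    simp only at h0 h1 h2 hu hv huv
    set a := (f x).1
    set b := (f x).2
    set p := (f (0, 0)).1
    set q := (f (0, 0)).2
    set u₁ := (f (1, 0)).1
    set u₂ := (f (1, 0)).2
    set v₁ := (f (0, 1)).1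
    set v₂ := (f (0, 1)).2
    have hu' : (u₁ - p) ^ 2 + (u₂ - q) ^ 2 = l ^ 2 := by linear_combination hu
    have hv' : (v₁ - p) ^ 2 + (v₂ - q) ^ 2 = l ^ 2 := by linear_combination hv
    have huv' : (u₁ - p) * (v₁ - p) + (u₂ - q) * (v₂ - q) = 0 := by
      linear_combination (-1 / 2) * huv + (1 / 2) * hu + (1 / 2) * hv
    have hau : (a - p) * (u₁ - p) + (b - q) * (u₂ - q) = l ^ 2 * x.1 := by
      linear_combination (-1 / 2) * h1 + (1 / 2) * hu + (1 / 2) * h0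
    have hav : (a - p) * (v₁ - p) + (b - q) * (v₂ - q) = l ^ 2 * x.2 := by
      linear_combination (-1 / 2) * h2 + (1 / 2) * hv + (1 / 2) * h0
    have hzero : (a - (p + (u₁ - p) * x.1 + (v₁ - p) * x.2)) ^ 2
        + (b - (q + (u₂ - q) * x.1 + (v₂ - q) * x.2)) ^ 2 = 0 := by
      linear_combination h0 + x.1 ^ 2 * hu' + x.2 ^ 2 * hv' + 2 * x.1 * x.2 * huv'
        - 2 * x.1 * hau - 2 * x.2 * hav
    have hs1 := sq_nonneg (a - (p + (u₁ - p) * x.1 + (v₁ - p) * x.2))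
    have hs2 := sq_nonneg (b - (q + (u₂ - q) * x.1 + (v₂ - q) * x.2))
    ext
    · exact sub_eq_zero.1 (pow_eq_zero_iff two_ne_zero |>.1 (by linarith))
    · exact sub_eq_zero.1 (pow_eq_zero_iff two_ne_zero |>.1 (by linarith))

/-- If all digit pairs share the same second entry then the carpet lies on a horizontal line. -/
lemma BMCarpet.onALine_of_row {j : ℕ} (h : ∀ x ∈ Λ, x.2 = j) : OnALine (BMCarpet n m Λ) := by
  refine ⟨0, 1, ∑' k : ℕ, (j : ℝ) / (m : ℝ) ^ (k + 1), Or.inr one_ne_zero, ?_⟩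
  rintro p ⟨d, hd, -, h2⟩
  rw [h2, zero_mul, one_mul, zero_add]
  exact tsum_congr fun k => by rw [h _ (hd k)]

end Main

theorem no_oblique_self_embedding_independent
    (n m : ℕ) (Λ : Finset (ℕ × ℕ))
    (hm : 2 ≤ m) (hnm : m < n)
    (hΛsub : Λ ⊆ Finset.range n ×ˢ Finset.range m)
    (hΛ1 : 1 < Λ.card) (hΛ2 : Λ.card < m * n)
    (hirr : Irrational (Real.log n / Real.log m))
    (hline : ¬ OnALine (BMCarpet n m Λ))
    (f : ℝ × ℝ → ℝ × ℝ) (l : ℝ) (hl : 0 < l)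
    (hf : IsSimilitude f l)
    (hsub : f '' BMCarpet n m Λ ⊆ BMCarpet n m Λ) :
    ¬ Oblique f := by
  intro ho
  obtain ⟨p, q, α, β, γ, δ, hα, hβ, hγ, hfeq⟩ := hf.eq_affine ho
  have hmap : ∀ x ∈ BMCarpet n m Λ,
      (p + α * x.1 + β * x.2, q + γ * x.1 + δ * x.2) ∈ BMCarpet n m Λ := fun x hx => by
    rw [← hfeq]
    exact hsub ⟨x, hx, rfl⟩
  let row : ℕ → Finset ℕ := fun j => (Λ.filter fun x => x.2 = j).image Prod.fst
  have hrow : ∀ {i j}, i ∈ row j ↔ (i, j) ∈ Λ := by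
    intro i j
    simp [row]
  obtain ⟨j, hj, hmax⟩ := Finset.exists_max_image (Finset.range m) (fun j => (row j).card)
    ⟨0, Finset.mem_range.2 (by omega)⟩
  have hN : ∀ j', (row j').card ≤ (row j).card := by
    intro j'
    by_cases hj' : j' < m
    · exact hmax j' (Finset.mem_range.2 hj')
    · have : row j' = ∅ := Finset.eq_empty_of_forall_notMem fun i hi =>
        hj' (Finset.mem_range.1 (Finset.mem_product.1 (hΛsub (hrow.1 hi))).2)
      simp [this]
  have hsubrow : row j ⊆ Finset.range n := fun i hi =>
    (Finset.mem_product.1 (hΛsub (hrow.1 hi))).1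
  obtain ⟨⟨i₀, j₀⟩, h0⟩ := Finset.card_pos.1 (by omega : 0 < Λ.card)
  have hne : (row j).Nonempty := by
    rw [← Finset.card_pos]
    exact (Finset.card_pos.2 ⟨i₀, hrow.2 h0⟩).trans_le (hN j₀)
  have hcard := Finset.card_le_card hsubrow
  rw [Finset.card_range] at hcard
  rcases hcard.lt_or_eq with hlt | heq
  · obtain ⟨⟨i₁, j₁⟩, h1, hj01⟩ : ∃ x ∈ Λ, x.2 ≠ j₀ := by
      by_contra! hcon
      exact hline (BMCarpet.onALine_of_row hcon)
    exact BMCarpet.no_oblique_affine hm hnm hΛsub (fun i hi => hrow.1 hi) hne hlt hN h0 h1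
      hj01.symm hα hβ hmap
  · have hfull : row j = Finset.range n :=
      Finset.eq_of_subset_of_card_le hsubrow (by rw [heq, Finset.card_range])
    obtain ⟨y, hy⟩ := BMCarpet.exists_horizontal_segment (m := m) (by omega : 2 ≤ n)
      fun i hi => hrow.1 (by rw [hfull]; exact Finset.mem_range.2 hi)
    refine BMCarpet.no_oblique_segment (p := p + β * y) (q := q + δ * y) hm hnm hΛsub hΛ2 hα hγ
      fun s hs0 hs1 => ?_
    convert hmap _ (hy s hs0 hs1) using 2 <;> ring
end
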